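/- Let Γ be a cyclic group of order k ≥ 4, let 2 ≤ j ≤ k−2, and let (G,ψ) be a ℤ_k^j-gain tight Γ-gain graph with a free vertex v of degree 3 which has no loop. Let (G₁,ψ₁) and (G₂,ψ₂) be obtained from (G,ψ) by applying two different 1-reductions at v, adding the edges f₁ and f₂ respectively, and suppose that for i = 1,2 the graph (G_i,ψ_i) has a blocker H_i; set H = H₁ ∪ H₂. If E(H₁ ∩ H₂) ≠ ∅, then |E(H)| = 2|V(H)| − 3 + α_k^j(H + f₁ + f₂). -/

import Mathlib

open scoped Classical

namespace GR

/-- A finite directed multigraph with edge labels ("gains") in a group `Γ` and a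
designated finite set of fixed vertices. -/
structure GainedGraph (V E Γ : Type) where
  tail : E → V
  head : E → V
  gain : E → Γ
  fixed : Finset V

variable {V E Γ : Type} [DecidableEq V] [DecidableEq E] [Fintype V] [Fintype E] [Group Γ]

/-- A subgraph: a set of vertices and a set of edges whose endpoints lie in the vertex set. -/
structure Subgraph (G : GainedGraph V E Γ) where
  verts : Finset V
  edges : Finset E
  tail_mem : ∀ e ∈ edges, G.tail e ∈ verts
  head_mem : ∀ e ∈ edges, G.head e ∈ verts

namespace Subgraph

variable {G : GainedGraph V E Γ}

instance : Top (Subgraph G) :=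
  ⟨⟨Finset.univ, Finset.univ, fun _ _ => Finset.mem_univ _, fun _ _ => Finset.mem_univ _⟩⟩

instance : LE (Subgraph G) :=
  ⟨fun H K => H.verts ⊆ K.verts ∧ H.edges ⊆ K.edges⟩

def union (H K : Subgraph G) : Subgraph G where
  verts := H.verts ∪ K.verts
  edges := H.edges ∪ K.edges
  tail_mem e he := by
    rcases Finset.mem_union.1 he with h | h
    · exact Finset.mem_union_left _ (H.tail_mem e h)
    · exact Finset.mem_union_right _ (K.tail_mem e h)
  head_mem e he := by
    rcases Finset.mem_union.1 he with h | h
    · exact Finset.mem_union_left _ (H.head_mem e h)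
    · exact Finset.mem_union_right _ (K.head_mem e h)

def inter (H K : Subgraph G) : Subgraph G where
  verts := H.verts ∩ K.verts
  edges := H.edges ∩ K.edges
  tail_mem e he := by
    rcases Finset.mem_inter.1 he with ⟨h1, h2⟩
    exact Finset.mem_inter.2 ⟨H.tail_mem e h1, K.tail_mem e h2⟩
  head_mem e he := by
    rcases Finset.mem_inter.1 he with ⟨h1, h2⟩
    exact Finset.mem_inter.2 ⟨H.head_mem e h1, K.head_mem e h2⟩

/-- Delete a vertex together with all edges incident to it. -/
def deleteVertex (H : Subgraph G) (v : V) : Subgraph G where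
  verts := H.verts.erase v
  edges := H.edges.filter fun e => G.tail e ≠ v ∧ G.head e ≠ v
  tail_mem e he := by
    rcases Finset.mem_filter.1 he with ⟨h1, h2, h3⟩
    exact Finset.mem_erase.2 ⟨h2, H.tail_mem e h1⟩
  head_mem e he := by
    rcases Finset.mem_filter.1 he with ⟨h1, h2, h3⟩
    exact Finset.mem_erase.2 ⟨h3, H.head_mem e h1⟩

/-- Delete an edge. -/
def deleteEdge (H : Subgraph G) (f : E) : Subgraph G where
  verts := H.verts
  edges := H.edges.erase f
  tail_mem e he := H.tail_mem e (Finset.mem_of_mem_erase he)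
  head_mem e he := H.head_mem e (Finset.mem_of_mem_erase he)

/-- Add an edge (together with its endpoints). -/
def addEdge (H : Subgraph G) (f : E) : Subgraph G where
  verts := insert (G.tail f) (insert (G.head f) H.verts)
  edges := insert f H.edges
  tail_mem e he := by
    rcases Finset.mem_insert.1 he with rfl | h
    · exact Finset.mem_insert_self _ _
    · exact Finset.mem_insert_of_mem (Finset.mem_insert_of_mem (H.tail_mem e h))
  head_mem e he := by
    rcases Finset.mem_insert.1 he with rfl | h
    · exact Finset.mem_insert_of_mem (Finset.mem_insert_self _ _)
    · exact Finset.mem_insert_of_mem (Finset.mem_insert_of_mem (H.head_mem e h))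

/-- The free vertices of a subgraph. -/
def freeVerts (H : Subgraph G) : Finset V := H.verts \ G.fixed

/-- The fixed vertices of a subgraph. -/
def fixedVerts (H : Subgraph G) : Finset V := H.verts ∩ G.fixed

end Subgraph

/-- The starting vertex of an oriented traversal of an edge. -/
def stepStart (G : GainedGraph V E Γ) (s : E × Bool) : V :=
  if s.2 then G.tail s.1 else G.head s.1

/-- The ending vertex of an oriented traversal of an edge. -/
def stepEnd (G : GainedGraph V E Γ) (s : E × Bool) : V :=
  if s.2 then G.head s.1 else G.tail s.1

/-- The gain contributed by an oriented traversal of an edge. -/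
def stepGain (G : GainedGraph V E Γ) (s : E × Bool) : Γ :=
  if s.2 then G.gain s.1 else (G.gain s.1)⁻¹

/-- `IsWalk G H L u w` : `L` is a walk in the subgraph `H` from `u` to `w`. -/
def IsWalk (G : GainedGraph V E Γ) (H : Subgraph G) : List (E × Bool) → V → V → Prop
  | [], u, w => u = w ∧ u ∈ H.verts
  | s :: L, u, w => s.1 ∈ H.edges ∧ stepStart G s = u ∧ IsWalk G H L (stepEnd G s) w

/-- The gain of a walk. -/
def walkGain (G : GainedGraph V E Γ) (L : List (E × Bool)) : Γ :=
  (L.map (stepGain G)).prod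

/-- The vertices visited by a walk starting at `u`. -/
def walkVerts (G : GainedGraph V E Γ) (u : V) (L : List (E × Bool)) : List V :=
  u :: L.map (stepEnd G)

/-- `⟨H⟩` : the subgroup of `Γ` generated by the gains of all closed walks in `H`
containing no fixed vertex. -/
def gainGroup (G : GainedGraph V E Γ) (H : Subgraph G) : Subgroup Γ :=
  Subgroup.closure
    {g | ∃ u L, IsWalk G H L u u ∧ (∀ x ∈ walkVerts G u L, x ∉ G.fixed) ∧ walkGain G L = g}

/-- A subgraph is balanced if its gain group is trivial. -/
def Balanced (G : GainedGraph V E Γ) (H : Subgraph G) : Prop := gainGroup G H = ⊥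

def Reachable (G : GainedGraph V E Γ) (H : Subgraph G) (u w : V) : Prop :=
  ∃ L, IsWalk G H L u w

def Connected (G : GainedGraph V E Γ) (H : Subgraph G) : Prop :=
  H.verts.Nonempty ∧ ∀ u ∈ H.verts, ∀ w ∈ H.verts, Reachable G H u w

/-- `v` is a cut-vertex of the subgraph `H`. -/
def IsCutVertex (G : GainedGraph V E Γ) (H : Subgraph G) (v : V) : Prop :=
  v ∈ H.verts ∧ ∃ u ∈ H.verts, ∃ w ∈ H.verts, u ≠ v ∧ w ≠ v ∧
    Reachable G H u w ∧ ¬ Reachable G (H.deleteVertex v) u w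

/-- `(2,m,l)`-sparsity of the subgraph `K`. -/
def Sparse (G : GainedGraph V E Γ) (m l : ℤ) (K : Subgraph G) : Prop :=
  ∀ H : Subgraph G, H ≤ K → H.edges.Nonempty →
    (H.edges.card : ℤ) ≤ 2 * (H.freeVerts.card : ℤ) + m * (H.fixedVerts.card : ℤ) - l

/-- `(2,m,l)`-tightness of the subgraph `K`. -/
def Tight (G : GainedGraph V E Γ) (m l : ℤ) (K : Subgraph G) : Prop :=
  Sparse G m l K ∧
    (K.edges.card : ℤ) = 2 * (K.freeVerts.card : ℤ) + m * (K.fixedVerts.card : ℤ) - l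

/-- `(2,m,3,l)`-gain-tightness: `(2,m,l)`-tight and every balanced subgraph with a
nonempty edge set is `(2,3)`-sparse. -/
def GainTight23 (G : GainedGraph V E Γ) (m l : ℤ) (K : Subgraph G) : Prop :=
  Tight G m l K ∧ ∀ H : Subgraph G, H ≤ K → H.edges.Nonempty → Balanced G H →
    (H.edges.card : ℤ) ≤ 2 * (H.verts.card : ℤ) - 3

/-- The subgraph has no fixed vertex. -/
def NoFixed (G : GainedGraph V E Γ) (H : Subgraph G) : Prop :=
  ∀ x ∈ H.verts, x ∉ G.fixed

/-- Near-balanced with base vertex `v` and gain `δ`: unbalanced, and every closed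
walk starting at `v` not containing `v` as an internal vertex has gain `1`, `δ` or `δ⁻¹`. -/
def NearBalancedAt (G : GainedGraph V E Γ) (H : Subgraph G) (v : V) (δ : Γ) : Prop :=
  ¬ Balanced G H ∧ ∀ L, IsWalk G H L v v →
    (∀ x ∈ (L.map (stepEnd G)).dropLast, x ≠ v) → walkGain G L ∈ ({1, δ, δ⁻¹} : Set Γ)

def NearBalanced (G : GainedGraph V E Γ) (H : Subgraph G) : Prop :=
  NoFixed G H ∧ ∃ v ∈ H.verts, ∃ δ : Γ, NearBalancedAt G H v δ

/-- The gain group of `H` is isomorphic to `ℤ_n`. -/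
def IsZIso (G : GainedGraph V E Γ) (H : Subgraph G) (n : ℕ) : Prop :=
  Nonempty (gainGroup G H ≃* Multiplicative (ZMod n))

def ProperNearBalanced (G : GainedGraph V E Γ) (H : Subgraph G) : Prop :=
  NearBalanced G H ∧ ¬ IsZIso G H 2 ∧ ¬ IsZIso G H 3

/-- The set `S_i(k,j)`. -/
def SSet (k j : ℕ) (i : ℤ) : Set ℕ :=
  {n | 2 ≤ n ∧ n ∣ k ∧ (Odd j → n ≠ 2) ∧ ((j : ZMod n) = (i : ZMod n))}

/-- `H` is `S_i(k,j)`. -/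
def IsS (G : GainedGraph V E Γ) (k j : ℕ) (i : ℤ) (H : Subgraph G) : Prop :=
  ∃ n ∈ SSet k j i, IsZIso G H n

/-- `H` is `S_{±1}(k,j)`. -/
def IsSpm (G : GainedGraph V E Γ) (k j : ℕ) (H : Subgraph G) : Prop :=
  IsS G k j (-1) H ∨ IsS G k j 1 H

/-- The function `α_k^j` on (connected) subgraphs. -/
noncomputable def alpha (G : GainedGraph V E Γ) (k j : ℕ) (X : Subgraph G) : ℤ :=
  if Balanced G X then 0
  else if Odd j ∧ IsZIso G X 2 then 1
  else if IsSpm G k j X then 2 - (X.fixedVerts.card : ℤ)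
  else if IsS G k j 0 X ∨ (X.fixedVerts.card = 0 ∧ ProperNearBalanced G X) then
    2 - 2 * (X.fixedVerts.card : ℤ)
  else 3 - 2 * (X.fixedVerts.card : ℤ)

/-- The subgraph spanned by a set of edges. -/
def edgeSpan (G : GainedGraph V E Γ) (F : Finset E) : Subgraph G where
  verts := F.image G.tail ∪ F.image G.head
  edges := F
  tail_mem e he := Finset.mem_union_left _ (Finset.mem_image_of_mem _ he)
  head_mem e he := Finset.mem_union_right _ (Finset.mem_image_of_mem _ he)

/-- The connected component of the edge `e` in the subgraph spanned by `F`. -/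
noncomputable def componentOf (G : GainedGraph V E Γ) (F : Finset E) (e : E) : Subgraph G :=
  edgeSpan G (F.filter fun f => Reachable G (edgeSpan G F) (G.tail e) (G.tail f))

/-- The connected components of the edge set `F`. -/
noncomputable def components (G : GainedGraph V E Γ) (F : Finset E) : Finset (Subgraph G) :=
  F.image (componentOf G F)

/-- The count `f_k^j(F) = Σ_{X ∈ C(F)} (2|V(X)| − 3 + α_k^j(X))`. -/
noncomputable def fCount (G : GainedGraph V E Γ) (k j : ℕ) (F : Finset E) : ℤ :=
  ∑ X ∈ components G F, (2 * (X.verts.card : ℤ) - 3 + alpha G k j X)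

/-- `ℤ_k^j`-gain sparsity. -/
def GainSparseKJ (G : GainedGraph V E Γ) (k j : ℕ) (K : Subgraph G) : Prop :=
  ∀ H : Subgraph G, H ≤ K → H.edges.Nonempty → (H.edges.card : ℤ) ≤ fCount G k j H.edges

/-- `ℤ_k^j`-gain tightness. -/
def GainTightKJ (G : GainedGraph V E Γ) (k j : ℕ) (K : Subgraph G) : Prop :=
  GainSparseKJ G k j K ∧ (K.edges.card : ℤ) = fCount G k j K.edges

/-- The degree of a vertex in a subgraph (a loop counts twice). -/
def degree (G : GainedGraph V E Γ) (K : Subgraph G) (v : V) : ℕ :=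
  (K.edges.filter fun e => G.tail e = v).card + (K.edges.filter fun e => G.head e = v).card

def HasLoopAt (G : GainedGraph V E Γ) (K : Subgraph G) (v : V) : Prop :=
  ∃ e ∈ K.edges, G.tail e = v ∧ G.head e = v

/-- The neighbours of a vertex in a subgraph. -/
def neighbors (G : GainedGraph V E Γ) (K : Subgraph G) (v : V) : Finset V :=
  ((K.edges.filter fun e => G.tail e = v).image G.head) ∪
    ((K.edges.filter fun e => G.head e = v).image G.tail)

/-- The subgraph `K` satisfies the axioms of a `Γ`-gain graph. -/
structure IsGainGraphOn (G : GainedGraph V E Γ) (K : Subgraph G) : Prop where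
  fixed_card : K.fixedVerts.card ≤ 1
  same_dir : ∀ e ∈ K.edges, ∀ f ∈ K.edges, e ≠ f → G.tail e = G.tail f →
    G.head e = G.head f → G.gain e ≠ G.gain f
  opp_dir : ∀ e ∈ K.edges, ∀ f ∈ K.edges, e ≠ f → G.tail e = G.head f →
    G.head e = G.tail f → G.gain e ≠ (G.gain f)⁻¹
  fixed_not_loop : ∀ e ∈ K.edges, G.tail e = G.head e → G.tail e ∉ G.fixed
  fixed_not_parallel : ∀ e ∈ K.edges, ∀ f ∈ K.edges, e ≠ f →
    (G.tail e ∈ G.fixed ∨ G.head e ∈ G.fixed) →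
    ({G.tail e, G.head e} : Finset V) ≠ {G.tail f, G.head f}
  loop_gain : ∀ e ∈ K.edges, G.tail e = G.head e → G.gain e ≠ 1

/-- `H` together with the vertex `v` and all edges of `G₀` incident to `v`. -/
def addVertexEdges (G : GainedGraph V E Γ) (G₀ H : Subgraph G) (v : V) : Subgraph G where
  verts := (H.verts ∪ {v}) ∪
    ((G₀.edges.filter fun e => G.tail e = v ∨ G.head e = v).image G.tail ∪
      (G₀.edges.filter fun e => G.tail e = v ∨ G.head e = v).image G.head)
  edges := H.edges ∪ G₀.edges.filter fun e => G.tail e = v ∨ G.head e = v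
  tail_mem e he := by
    rcases Finset.mem_union.1 he with h | h
    · exact Finset.mem_union_left _ (Finset.mem_union_left _ (H.tail_mem e h))
    · exact Finset.mem_union_right _ (Finset.mem_union_left _ (Finset.mem_image_of_mem _ h))
  head_mem e he := by
    rcases Finset.mem_union.1 he with h | h
    · exact Finset.mem_union_left _ (Finset.mem_union_left _ (H.head_mem e h))
    · exact Finset.mem_union_right _ (Finset.mem_union_right _ (Finset.mem_image_of_mem _ h))

/-- The result of a 1-reduction at `v` adding the edge `f`: delete `v` and all edges at
`v` and add the edge `f`. -/
def reduceAt (G : GainedGraph V E Γ) (G₀ : Subgraph G) (v : V) (f : E) : Subgraph G where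
  verts := insert (G.tail f) (insert (G.head f) (G₀.verts.erase v))
  edges := insert f (G₀.edges.filter fun e => G.tail e ≠ v ∧ G.head e ≠ v)
  tail_mem e he := by
    rcases Finset.mem_insert.1 he with rfl | h
    · exact Finset.mem_insert_self _ _
    · rcases Finset.mem_filter.1 h with ⟨h1, h2, h3⟩
      exact Finset.mem_insert_of_mem
        (Finset.mem_insert_of_mem (Finset.mem_erase.2 ⟨h2, G₀.tail_mem e h1⟩))
  head_mem e he := by
    rcases Finset.mem_insert.1 he with rfl | h
    · exact Finset.mem_insert_of_mem (Finset.mem_insert_self _ _)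
    · rcases Finset.mem_filter.1 h with ⟨h1, h2, h3⟩
      exact Finset.mem_insert_of_mem
        (Finset.mem_insert_of_mem (Finset.mem_erase.2 ⟨h3, G₀.head_mem e h1⟩))

/-- The new edge `f` arises from a 1-reduction at the vertex `v` of `G₀`: its endpoints are
joined to `v` by two distinct edges of `G₀` and its gain is the gain of the corresponding
path of length two through `v`. -/
def IsOneReduction (G : GainedGraph V E Γ) (G₀ : Subgraph G) (v : V) (f : E) : Prop :=
  f ∉ G₀.edges ∧ G.tail f ≠ v ∧ G.head f ≠ v ∧
    ∃ s₁ s₂ : E × Bool, s₁.1 ∈ G₀.edges ∧ s₂.1 ∈ G₀.edges ∧ s₁.1 ≠ s₂.1 ∧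
      stepEnd G s₁ = v ∧ stepStart G s₂ = v ∧
      G.tail f = stepStart G s₁ ∧ G.head f = stepEnd G s₂ ∧
      G.gain f = stepGain G s₁ * stepGain G s₂

/-- Two labelled edges coincide (up to reorientation with gain inversion). -/
def SameEdge (G : GainedGraph V E Γ) (e f : E) : Prop :=
  (G.tail e = G.tail f ∧ G.head e = G.head f ∧ G.gain e = G.gain f) ∨
    (G.tail e = G.head f ∧ G.head e = G.tail f ∧ G.gain e = (G.gain f)⁻¹)

/-- `H` is a blocker of the 1-reduction at `v` adding the edge `f`. -/
def IsBlocker (G : GainedGraph V E Γ) (k j : ℕ) (G₀ : Subgraph G) (v : V) (f : E)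
    (H : Subgraph G) : Prop :=
  H ≤ G₀ ∧ v ∉ H.verts ∧ G.tail f ∈ H.verts ∧ G.head f ∈ H.verts ∧ H.edges.Nonempty ∧
    Connected G (H.addEdge f) ∧
    (H.edges.card : ℤ) = 2 * (H.verts.card : ℤ) - 3 + alpha G k j (H.addEdge f)

/-- The graph `G` extended by one fresh edge `none` with tail `t`, head `h` and gain `g`. -/
def extendGraph (G : GainedGraph V E Γ) (t h : V) (g : Γ) : GainedGraph V (Option E) Γ where
  tail e := e.elim t G.tail
  head e := e.elim h G.head
  gain e := e.elim g G.gain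
  fixed := G.fixed

/-- The whole original graph `G`, viewed inside the extension. -/
def extendTop (G : GainedGraph V E Γ) (t h : V) (g : Γ) : Subgraph (extendGraph G t h g) where
  verts := Finset.univ
  edges := Finset.univ.image Option.some
  tail_mem _ _ := Finset.mem_univ _
  head_mem _ _ := Finset.mem_univ _

/-- There is an admissible 1-reduction at `v`, i.e. a choice of new edge (with
endpoints and gain coming from a path of length two through `v`) such that the
resulting `Γ`-gain graph is well defined and `ℤ_k^j`-gain tight. -/
def AdmissibleOneReductionExists (G : GainedGraph V E Γ) (k j : ℕ) (v : V) : Prop :=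
  ∃ t h : V, ∃ g : Γ,
    IsOneReduction (extendGraph G t h g) (extendTop G t h g) v none ∧
    IsGainGraphOn (extendGraph G t h g)
      (reduceAt (extendGraph G t h g) (extendTop G t h g) v none) ∧
    GainTightKJ (extendGraph G t h g) k j
      (reduceAt (extendGraph G t h g) (extendTop G t h g) v none)

end GR

namespace GR

section Walks

variable {V E Γ : Type} {G : GainedGraph V E Γ}

theorem Subgraph.ext_sets {H K : Subgraph G} (hv : H.verts = K.verts) (he : H.edges = K.edges) :
    H = K := by
  cases H; cases K; simp_all

/-- The reversal of an oriented traversal of an edge. -/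
def stepRev (s : E × Bool) : E × Bool := (s.1, !s.2)

@[simp] theorem stepRev_fst (s : E × Bool) : (stepRev s).1 = s.1 := rfl

@[simp] theorem stepStart_stepRev (s : E × Bool) : stepStart G (stepRev s) = stepEnd G s := by
  rcases s with ⟨e, _ | _⟩ <;> simp [stepRev, stepStart, stepEnd]

@[simp] theorem stepEnd_stepRev (s : E × Bool) : stepEnd G (stepRev s) = stepStart G s := by
  rcases s with ⟨e, _ | _⟩ <;> simp [stepRev, stepStart, stepEnd]

@[simp] theorem stepGain_stepRev [Group Γ] (s : E × Bool) :
    stepGain G (stepRev s) = (stepGain G s)⁻¹ := by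
  rcases s with ⟨e, _ | _⟩ <;> simp [stepRev, stepGain]

theorem stepStart_mem {H : Subgraph G} {s : E × Bool} (hs : s.1 ∈ H.edges) :
    stepStart G s ∈ H.verts := by
  unfold stepStart; split_ifs
  exacts [H.tail_mem _ hs, H.head_mem _ hs]

theorem stepEnd_mem {H : Subgraph G} {s : E × Bool} (hs : s.1 ∈ H.edges) :
    stepEnd G s ∈ H.verts := by
  unfold stepEnd; split_ifs
  exacts [H.head_mem _ hs, H.tail_mem _ hs]

theorem stepStart_eq_or (s : E × Bool) :
    (stepStart G s = G.tail s.1 ∧ stepEnd G s = G.head s.1) ∨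
      (stepStart G s = G.head s.1 ∧ stepEnd G s = G.tail s.1) := by
  rcases s with ⟨e, _ | _⟩ <;> simp [stepStart, stepEnd]

theorem walkGain_nil [Group Γ] : walkGain G [] = 1 := rfl

theorem walkGain_cons [Group Γ] (s : E × Bool) (L : List (E × Bool)) :
    walkGain G (s :: L) = stepGain G s * walkGain G L := by
  simp [walkGain]

theorem walkGain_append [Group Γ] (L M : List (E × Bool)) :
    walkGain G (L ++ M) = walkGain G L * walkGain G M := by
  simp [walkGain]

theorem IsWalk.mem_right {H : Subgraph G} {L : List (E × Bool)} {u w : V}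
    (h : IsWalk G H L u w) : w ∈ H.verts := by
  induction L generalizing u with
  | nil => exact h.1 ▸ h.2
  | cons s L ih => exact ih h.2.2

theorem IsWalk.append {H : Subgraph G} {L M : List (E × Bool)} {u w x : V}
    (h : IsWalk G H L u w) (h' : IsWalk G H M w x) : IsWalk G H (L ++ M) u x := by
  induction L generalizing u with
  | nil => obtain ⟨rfl, -⟩ := h; exact h'
  | cons s L ih => exact ⟨h.1, h.2.1, ih h.2.2⟩

theorem isWalk_single {H : Subgraph G} {s : E × Bool} (hs : s.1 ∈ H.edges) :
    IsWalk G H [s] (stepStart G s) (stepEnd G s) :=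
  ⟨hs, rfl, rfl, stepEnd_mem hs⟩

theorem IsWalk.mono {H K : Subgraph G} (hHK : H ≤ K) {L : List (E × Bool)} {u w : V}
    (h : IsWalk G H L u w) : IsWalk G K L u w := by
  induction L generalizing u with
  | nil => exact ⟨h.1, hHK.1 h.2⟩
  | cons s L ih => exact ⟨hHK.2 h.1, h.2.1, ih h.2.2⟩

/-- A walk that avoids a vertex can be reversed, inverting the gain. -/
theorem IsWalk.exists_reverse [CommGroup Γ] {H : Subgraph G} {P : V → Prop}
    {L : List (E × Bool)} {y w : V}
    (h : IsWalk G H L y w) (hy : P y) (hL : ∀ x ∈ L.map (stepEnd G), P x) :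
    ∃ M, IsWalk G H M w y ∧ walkGain G M = (walkGain G L)⁻¹ ∧
      ∀ x ∈ M.map (stepEnd G), P x := by
  induction L generalizing y with
  | nil =>
    obtain ⟨rfl, hm⟩ := h
    exact ⟨[], ⟨rfl, hm⟩, by simp [walkGain_nil], by simp⟩
  | cons s L ih =>
    obtain ⟨hs, rfl, hL'⟩ := h
    simp only [List.map_cons, List.mem_cons, forall_eq_or_imp] at hL
    obtain ⟨M, hM, hg, hx⟩ := ih hL' hL.1 hL.2
    refine ⟨M ++ [stepRev s], hM.append ?_, ?_, ?_⟩
    · simpa using isWalk_single (G := G) (H := H) (s := stepRev s) hs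
    · rw [walkGain_append, hg, walkGain_cons, walkGain_cons, walkGain_nil, stepGain_stepRev,
        mul_inv, mul_one, mul_comm]
    · intro x hxm
      simp only [List.map_append, List.map_cons, List.map_nil, stepEnd_stepRev, List.mem_append,
        List.mem_singleton] at hxm
      rcases hxm with hxm | rfl
      exacts [hx x hxm, hy]

theorem Reachable.refl {H : Subgraph G} {u : V} (hu : u ∈ H.verts) : Reachable G H u u :=
  ⟨[], rfl, hu⟩

theorem Reachable.trans {H : Subgraph G} {u w x : V} (h : Reachable G H u w)
    (h' : Reachable G H w x) : Reachable G H u x := by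
  obtain ⟨L, hL⟩ := h
  obtain ⟨M, hM⟩ := h'
  exact ⟨L ++ M, hL.append hM⟩

theorem Reachable.step {H : Subgraph G} {s : E × Bool} (hs : s.1 ∈ H.edges) :
    Reachable G H (stepStart G s) (stepEnd G s) :=
  ⟨[s], isWalk_single hs⟩

theorem Reachable.symm {H : Subgraph G} {u w : V} (h : Reachable G H u w) :
    Reachable G H w u := by
  obtain ⟨L, hL⟩ := h
  induction L generalizing u with
  | nil => obtain ⟨rfl, hm⟩ := hL; exact .refl hm
  | cons s L ih =>
    obtain ⟨hs, rfl, hL'⟩ := hL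
    refine (ih hL').trans ?_
    simpa using Reachable.step (G := G) (H := H) (s := stepRev s) hs

theorem Reachable.mono {H K : Subgraph G} (hHK : H ≤ K) {u w : V} (h : Reachable G H u w) :
    Reachable G K u w := by
  obtain ⟨L, hL⟩ := h
  exact ⟨L, hL.mono hHK⟩

/-- A property preserved along the edges is inherited by reachable vertices. -/
theorem Reachable.induct {H : Subgraph G} {P : V → Prop}
    (hP : ∀ s : E × Bool, s.1 ∈ H.edges → P (stepStart G s) → P (stepEnd G s))
    {u w : V} (h : Reachable G H u w) (hu : P u) : P w := by
  obtain ⟨L, hL⟩ := h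
  induction L generalizing u with
  | nil => obtain ⟨rfl, -⟩ := hL; exact hu
  | cons s L ih =>
    obtain ⟨hs, rfl, hL'⟩ := hL
    exact ih (hP s hs hu) hL'

theorem Connected.exists_incident {H : Subgraph G} (hH : Connected G H) (hE : H.edges.Nonempty)
    {x : V} (hx : x ∈ H.verts) : ∃ s : E × Bool, s.1 ∈ H.edges ∧ stepStart G s = x := by
  obtain ⟨e, he⟩ := hE
  obtain ⟨L, hL⟩ := hH.2 x hx (G.tail e) (H.tail_mem e he)
  cases L with
  | nil => exact ⟨(e, true), he, by simp [stepStart, hL.1]⟩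
  | cons s L => exact ⟨s, hL.1, hL.2.1⟩

end Walks

section Potentials

set_option linter.unusedSectionVars false

variable {V E Γ : Type} [DecidableEq V] {G : GainedGraph V E Γ}

/-- The subgraph of `X` induced on its free vertices. -/
def freePart (X : Subgraph G) : Subgraph G where
  verts := X.freeVerts
  edges := X.edges.filter fun e => G.tail e ∉ G.fixed ∧ G.head e ∉ G.fixed
  tail_mem e he := by
    rw [Finset.mem_filter] at he
    exact Finset.mem_sdiff.2 ⟨X.tail_mem e he.1, he.2.1⟩
  head_mem e he := by
    rw [Finset.mem_filter] at he
    exact Finset.mem_sdiff.2 ⟨X.head_mem e he.1, he.2.2⟩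

theorem mem_freePart_edges {X : Subgraph G} {s : E × Bool} :
    s.1 ∈ (freePart X).edges ↔
      s.1 ∈ X.edges ∧ stepStart G s ∉ G.fixed ∧ stepEnd G s ∉ G.fixed := by
  rcases s with ⟨e, _ | _⟩ <;> simp [freePart, stepStart, stepEnd, and_comm]

theorem freePart_le (X : Subgraph G) : freePart X ≤ X :=
  ⟨Finset.sdiff_subset, Finset.filter_subset _ _⟩

theorem freePart_mono {X Y : Subgraph G} (h : X ≤ Y) : freePart X ≤ freePart Y :=
  ⟨Finset.sdiff_subset_sdiff h.1 (Finset.Subset.refl _),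
    Finset.filter_subset_filter _ h.2⟩

theorem isWalk_freePart_iff {X : Subgraph G} {L : List (E × Bool)} {u w : V} :
    IsWalk G (freePart X) L u w ↔
      IsWalk G X L u w ∧ ∀ x ∈ walkVerts G u L, x ∉ G.fixed := by
  induction L generalizing u with
  | nil =>
    simp only [IsWalk, walkVerts, List.map_nil, List.mem_singleton, forall_eq]
    constructor
    · rintro ⟨rfl, h⟩
      exact ⟨⟨rfl, (Finset.mem_sdiff.1 h).1⟩, (Finset.mem_sdiff.1 h).2⟩
    · rintro ⟨⟨rfl, h⟩, h'⟩
      exact ⟨rfl, Finset.mem_sdiff.2 ⟨h, h'⟩⟩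
  | cons s L ih =>
    simp only [IsWalk, walkVerts, List.map_cons, List.mem_cons, forall_eq_or_imp] at ih ⊢
    rw [ih, mem_freePart_edges]
    constructor
    · rintro ⟨⟨h1, h2, h3⟩, rfl, h4, h5⟩
      exact ⟨⟨h1, rfl, h4⟩, h2, h5⟩
    · rintro ⟨⟨h1, rfl, h4⟩, h2, h5, h6⟩
      exact ⟨⟨h1, h2, h5⟩, rfl, h4, h5, h6⟩

variable [CommGroup Γ]

/-- The gain of a step, corrected by the vertex potential `p`. -/
def label (G : GainedGraph V E Γ) (p : V → Γ) (s : E × Bool) : Γ :=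
  p (stepStart G s) * stepGain G s * (p (stepEnd G s))⁻¹

theorem label_stepRev (p : V → Γ) (s : E × Bool) :
    label G p (stepRev s) = (label G p s)⁻¹ := by
  simp only [label, stepStart_stepRev, stepEnd_stepRev, stepGain_stepRev, mul_inv, inv_inv]
  simp only [mul_comm, mul_assoc]

/-- The `c`-th power of the gain function is trivial on the closed walks of the free part
of `X`, witnessed by a potential. -/
def PowBalanced (c : ℕ) (X : Subgraph G) : Prop :=
  ∃ p : V → Γ, ∀ s : E × Bool, s.1 ∈ (freePart X).edges →
    p (stepStart G s) * stepGain G s ^ c = p (stepEnd G s)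

theorem PowBalanced.mono {c : ℕ} {X Y : Subgraph G} (h : X ≤ Y) (hY : PowBalanced c Y) :
    PowBalanced c X := by
  obtain ⟨p, hp⟩ := hY
  exact ⟨p, fun s hs => hp s ((freePart_mono h).2 hs)⟩

theorem gainGroup_eq (X : Subgraph G) :
    gainGroup G X =
      Subgroup.closure {g | ∃ u L, IsWalk G (freePart X) L u u ∧ walkGain G L = g} := by
  unfold gainGroup
  congr 1
  ext g
  simp only [isWalk_freePart_iff, Set.mem_ofPred_eq, and_assoc]

theorem powBalanced_iff (c : ℕ) (X : Subgraph G) :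
    PowBalanced c X ↔ ∀ g ∈ gainGroup G X, g ^ c = 1 := by
  constructor
  · rintro ⟨p, hp⟩
    have key : ∀ L : List (E × Bool), ∀ u w, IsWalk G (freePart X) L u w →
        p u * walkGain G L ^ c = p w := by
      intro L
      induction L with
      | nil => rintro u w ⟨rfl, -⟩; simp [walkGain_nil]
      | cons s L ih =>
        rintro u w ⟨hs, rfl, hL⟩
        rw [walkGain_cons, mul_pow, ← mul_assoc, hp s hs, ih _ _ hL]
    have hle : gainGroup G X ≤ (powMonoidHom c : Γ →* Γ).ker := by
      rw [gainGroup_eq, Subgroup.closure_le]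
      rintro g ⟨u, L, hL, rfl⟩
      simpa [MonoidHom.mem_ker] using key L u u hL
    exact fun g hg => by simpa [MonoidHom.mem_ker] using hle hg
  · intro h
    let R : V → V → Prop := Reachable G (freePart X)
    have hR : ∀ x : V, ∃ b : V, ∃ L, x ∈ (freePart X).verts →
        b = @Classical.epsilon V ⟨x⟩ (R x) ∧ IsWalk G (freePart X) L b x := by
      intro x
      by_cases hx : x ∈ (freePart X).verts
      · have : R x (@Classical.epsilon V ⟨x⟩ (R x)) := by
          have : Nonempty V := ⟨x⟩
          exact Classical.epsilon_spec (p := R x) ⟨x, Reachable.refl hx⟩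
        obtain ⟨L, hL⟩ := this.symm
        exact ⟨_, L, fun _ => ⟨rfl, hL⟩⟩
      · exact ⟨x, [], fun h => absurd h hx⟩
    choose b L hbL using hR
    refine ⟨fun x => walkGain G (L x) ^ c, fun s hs => ?_⟩
    obtain ⟨hb1, hw1⟩ := hbL _ (stepStart_mem hs)
    obtain ⟨hb2, hw2⟩ := hbL _ (stepEnd_mem hs)
    have hRR : R (stepStart G s) = R (stepEnd G s) := by
      funext y
      exact propext ⟨fun hy => (Reachable.step hs).symm.trans hy,
        fun hy => (Reachable.step hs).trans hy⟩
    have hbb : b (stepStart G s) = b (stepEnd G s) := by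
      rw [hb1, hb2, hRR]
    rw [hbb] at hw1
    obtain ⟨M, hM, hMg, -⟩ := hw2.exists_reverse (P := fun _ => True) trivial (by simp)
    have hcl := (hw1.append (isWalk_single hs)).append hM
    have := h (walkGain G (L (stepStart G s) ++ [s] ++ M)) (by
      rw [gainGroup_eq]
      exact Subgroup.subset_closure ⟨_, _, hcl, rfl⟩)
    rw [walkGain_append, walkGain_append, hMg, walkGain_cons, walkGain_nil, mul_one, mul_pow,
      mul_pow, inv_pow, mul_inv_eq_one] at this
    exact this

theorem balanced_iff_powBalanced (X : Subgraph G) : Balanced G X ↔ PowBalanced 1 X := by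
  rw [powBalanced_iff, Balanced, Subgroup.eq_bot_iff_forall]
  simp

theorem PowBalanced.one_of_succ {c : ℕ} {X : Subgraph G} (h : PowBalanced c X)
    (h' : PowBalanced (c + 1) X) : PowBalanced 1 X := by
  rw [powBalanced_iff] at *
  intro g hg
  have := h' g hg
  rwa [pow_succ, h g hg, one_mul, ← pow_one g] at this

/-- Potentials glue along a subgraph whose free part is connected. -/
theorem PowBalanced.glue {c : ℕ} {X Y Z I : Subgraph G} {w : V}
    (hX : PowBalanced c X) (hY : PowBalanced c Y) (hIX : I ≤ X) (hIY : I ≤ Y)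
    (hI : X.verts ∩ Y.verts ⊆ I.verts) (hZ : ∀ e ∈ Z.edges, e ∈ X.edges ∨ e ∈ Y.edges)
    (hconn : ∀ x ∈ I.freeVerts, Reachable G (freePart I) w x) : PowBalanced c Z := by
  obtain ⟨p, hp⟩ := hX
  obtain ⟨q, hq⟩ := hY
  have hpq : ∀ x ∈ I.freeVerts, q x * (p x)⁻¹ = q w * (p w)⁻¹ := by
    intro x hx
    refine (hconn x hx).induct (P := fun x => q x * (p x)⁻¹ = q w * (p w)⁻¹) ?_ rfl
    intro s hs h
    rw [← hp s ((freePart_mono hIX).2 hs), ← hq s ((freePart_mono hIY).2 hs), ← h]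
    simp only [mul_inv]
    rw [mul_mul_mul_comm, mul_inv_cancel, mul_one]
  set r := q w * (p w)⁻¹ with hr
  refine ⟨fun x => if x ∈ X.verts then p x else q x * r⁻¹, fun s hs => ?_⟩
  have hYeq : ∀ x ∈ Y.verts, x ∉ G.fixed →
      (if x ∈ X.verts then p x else q x * r⁻¹) = q x * r⁻¹ := by
    intro x hx hf
    split_ifs with hxX
    · have := hpq x (Finset.mem_sdiff.2 ⟨hI (Finset.mem_inter.2 ⟨hxX, hx⟩), hf⟩)
      rw [← this]; simp
    · rfl
  rw [mem_freePart_edges] at hs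
  rcases hZ _ hs.1 with h | h
  · simp only [stepStart_mem h, stepEnd_mem h, if_true]
    exact hp s (mem_freePart_edges.2 ⟨h, hs.2⟩)
  · beta_reduce
    rw [hYeq _ (stepStart_mem h) hs.2.1, hYeq _ (stepEnd_mem h) hs.2.2,
      ← hq s (mem_freePart_edges.2 ⟨h, hs.2⟩), mul_right_comm]

end Potentials

section NearBalanced

set_option linter.unusedSectionVars false

variable {V E Γ : Type} [DecidableEq V] [CommGroup Γ] {G : GainedGraph V E Γ}

theorem label_mul (p m : V → Γ) (s : E × Bool) :
    label G (fun x => p x * m x) s =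
      m (stepStart G s) * (m (stepEnd G s))⁻¹ * label G p s := by
  simp only [label, mul_inv]
  simp only [mul_comm, mul_left_comm, mul_assoc]

theorem label_congr {p q : V → Γ} {s : E × Bool} (h1 : p (stepStart G s) = q (stepStart G s))
    (h2 : p (stepEnd G s) = q (stepEnd G s)) : label G p s = label G q s := by
  simp only [label, h1, h2]

theorem label_eq_gain {p : V → Γ} {s : E × Bool} (h : stepStart G s = stepEnd G s) :
    label G p s = stepGain G s := by
  rw [label, h, mul_comm (p _), mul_inv_cancel_right]

theorem PowBalanced.of_label_pow {c : ℕ} {X : Subgraph G} (p : V → Γ)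
    (h : ∀ s : E × Bool, s.1 ∈ (freePart X).edges → label G p s ^ c = 1) : PowBalanced c X := by
  refine ⟨fun x => p x ^ c, fun s hs => ?_⟩
  have := h s hs
  rwa [label, mul_pow, mul_pow, inv_pow, mul_inv_eq_one] at this

theorem powBalanced_one_iff {X : Subgraph G} :
    PowBalanced 1 X ↔
      ∃ p : V → Γ, ∀ s : E × Bool, s.1 ∈ (freePart X).edges → label G p s = 1 := by
  simp only [PowBalanced, pow_one, label, mul_inv_eq_one]

theorem NoFixed.mem_freePart {X : Subgraph G} (hX : NoFixed G X) {s : E × Bool} :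
    s.1 ∈ (freePart X).edges ↔ s.1 ∈ X.edges := by
  rw [mem_freePart_edges]
  exact ⟨fun h => h.1, fun h => ⟨h, hX _ (stepStart_mem h), hX _ (stepEnd_mem h)⟩⟩

/-- The potential `p` exhibits near-balancedness of `X` with base vertex `u` and gain `δ`. -/
def NearPotential (X : Subgraph G) (u : V) (δ : Γ) (p : V → Γ) : Prop :=
  ∀ s : E × Bool, s.1 ∈ X.edges →
    (stepStart G s ≠ u → stepEnd G s ≠ u → label G p s = 1) ∧
    (stepStart G s = u → stepEnd G s ≠ u → label G p s = 1 ∨ label G p s = δ) ∧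
    (stepStart G s = u → stepEnd G s = u →
      label G p s = 1 ∨ label G p s = δ ∨ label G p s = δ⁻¹)

theorem NearPotential.label_mem {X : Subgraph G} {u : V} {δ : Γ} {p : V → Γ}
    (h : NearPotential X u δ p) {s : E × Bool} (hs : s.1 ∈ X.edges) :
    label G p s = 1 ∨ label G p s = δ ∨ label G p s = δ⁻¹ := by
  by_cases h1 : stepStart G s = u
  · by_cases h2 : stepEnd G s = u
    · exact (h s hs).2.2 h1 h2
    · rcases (h s hs).2.1 h1 h2 with h | h <;> simp [h]
  · by_cases h2 : stepEnd G s = u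
    · have := (h (stepRev s) hs).2.1 (by simpa using h2) (by simpa using h1)
      rw [label_stepRev, inv_eq_one, inv_eq_iff_eq_inv] at this
      tauto
    · exact Or.inl ((h s hs).1 h1 h2)

theorem NearPotential.of_union {X Y Z : Subgraph G} {u : V} {δ : Γ} {p : V → Γ}
    (hX : NearPotential X u δ p) (hY : NearPotential Y u δ p)
    (hZ : ∀ e ∈ Z.edges, e ∈ X.edges ∨ e ∈ Y.edges) : NearPotential Z u δ p :=
  fun s hs => (hZ _ hs).elim (hX s) (hY s)

theorem NearPotential.congr {X : Subgraph G} {u : V} {δ : Γ} {p q : V → Γ}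
    (hX : NearPotential X u δ p) (h : ∀ x ∈ X.verts, q x = p x) : NearPotential X u δ q := by
  intro s hs
  rw [label_congr (h _ (stepStart_mem hs)) (h _ (stepEnd_mem hs))]
  exact hX s hs

theorem NearPotential.const_mul {X : Subgraph G} {u : V} {δ : Γ} {p : V → Γ}
    (hX : NearPotential X u δ p) (r : Γ) : NearPotential X u δ (fun x => p x * r) := by
  intro s hs
  rw [label_mul p (fun _ => r), mul_inv_cancel, one_mul]
  exact hX s hs

/-- Inverting the gain of a near-balanced subgraph shifts the potential at the base vertex. -/
theorem NearPotential.inv {X : Subgraph G} {u : V} {δ : Γ} {p : V → Γ}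
    (hX : NearPotential X u δ p) :
    NearPotential X u δ⁻¹ (fun x => p x * if x = u then δ⁻¹ else 1) := by
  intro s hs
  obtain ⟨h1, h2, h3⟩ := hX s hs
  rw [label_mul p (fun x => if x = u then δ⁻¹ else 1)]
  refine ⟨fun a b => ?_, fun a b => ?_, fun a b => ?_⟩
  · simp [a, b, h1 a b]
  · rcases h2 a b with h | h <;> simp [a, b, h]
  · rcases h3 a b with h | h | h <;> simp [a, b, h]

/-- A balanced subgraph whose potential is shifted by `δ` at `u`. -/
theorem nearPotential_of_shift {X : Subgraph G} {u : V} {δ : Γ} {q p : V → Γ}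
    (hq : ∀ s : E × Bool, s.1 ∈ X.edges → label G q s = 1)
    (hp : ∀ x ∈ X.verts, p x = q x * if x = u then δ else 1) : NearPotential X u δ p := by
  intro s hs
  rw [label_congr (q := fun x => q x * if x = u then δ else 1) (hp _ (stepStart_mem hs))
    (hp _ (stepEnd_mem hs)), label_mul q (fun x => if x = u then δ else 1), hq s hs]
  refine ⟨fun a b => ?_, fun a b => ?_, fun a b => ?_⟩ <;> simp [a, b]

theorem nearPotential_of_label_one {X : Subgraph G} {u : V} {δ : Γ} {q : V → Γ}
    (hq : ∀ s : E × Bool, s.1 ∈ X.edges → label G q s = 1) : NearPotential X u δ q :=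
  fun s hs => by simp [hq s hs]

/-- A near-balanced subgraph is balanced away from the base vertex. -/
theorem NearPotential.powBalanced_of_notMem {P X : Subgraph G} {u : V} {δ : Γ} {p : V → Γ}
    (hX : NearPotential X u δ p) (hPX : P ≤ X) (hu : u ∉ P.verts) : PowBalanced 1 P := by
  refine powBalanced_one_iff.2 ⟨p, fun s hs => ?_⟩
  have hs' := (freePart_le P).2 hs
  exact (hX s (hPX.2 hs')).1 (fun h => hu (h ▸ stepStart_mem hs'))
    (fun h => hu (h ▸ stepEnd_mem hs'))

theorem NearPotential.powBalanced_of_pow {X : Subgraph G} {u : V} {δ : Γ} {p : V → Γ} {c : ℕ}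
    (hX : NearPotential X u δ p) (hδ : δ ^ c = 1) : PowBalanced c X := by
  refine PowBalanced.of_label_pow p fun s hs => ?_
  rcases hX.label_mem ((freePart_le X).2 hs) with h | h | h <;> simp [h, hδ]

/-- In a near-balanced subgraph, the power of the gain function that trivialises a subgraph
but not the whole can only do so because the subgraph is balanced. -/
theorem NearPotential.powBalanced_one {P X : Subgraph G} {u : V} {δ : Γ} {p : V → Γ} {c : ℕ}
    (hX : NearPotential X u δ p) (hc : ¬ PowBalanced c X) (hPX : P ≤ X)
    (hP : PowBalanced c P) : PowBalanced 1 P := by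
  have hδ : δ ^ c ≠ 1 := fun h => hc (hX.powBalanced_of_pow h)
  obtain ⟨q, hq⟩ := hP
  let r : V → Γ := fun x => q x * (p x ^ c)⁻¹
  have hr : ∀ s : E × Bool, s.1 ∈ (freePart P).edges →
      r (stepStart G s) * label G p s ^ c = r (stepEnd G s) := by
    intro s hs
    simp only [r, label, ← hq s hs, mul_pow, inv_pow]
    rw [mul_assoc, mul_assoc (p (stepStart G s) ^ c), inv_mul_cancel_left, mul_assoc]
  refine powBalanced_one_iff.2
    ⟨fun x => p x * if x = u ∨ r x = r u then 1 else δ, ?_⟩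
  have main : ∀ s : E × Bool, s.1 ∈ (freePart P).edges → stepEnd G s ≠ u →
      label G (fun x => p x * if x = u ∨ r x = r u then 1 else δ) s = 1 := by
    intro s hs h2
    have hlab := hr s hs
    obtain ⟨a1, a2, -⟩ := hX s (hPX.2 ((freePart_le P).2 hs))
    rw [label_mul p (fun x => if x = u ∨ r x = r u then 1 else δ)]
    by_cases h1 : stepStart G s = u
    · rw [h1] at hlab
      rcases a2 h1 h2 with h | h
      · rw [h, one_pow, mul_one] at hlab
        simp [h, h1, hlab]
      · have : r (stepEnd G s) ≠ r u := by
          rw [← hlab, h]; simpa using hδ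
        simp [h, h1, h2, this]
    · rw [a1 h1 h2, one_pow, mul_one] at hlab
      simp [a1 h1 h2, h1, h2, hlab]
  intro s hs
  by_cases h2 : stepEnd G s = u
  · by_cases h1 : stepStart G s = u
    · have hlab := hr s hs
      rw [h1, h2, mul_eq_left] at hlab
      rw [label_eq_gain (h1.trans h2.symm), ← label_eq_gain (p := p) (h1.trans h2.symm)]
      rcases hX.label_mem (hPX.2 ((freePart_le P).2 hs)) with h | h | h
      · exact h
      · exact absurd (h ▸ hlab) hδ
      · rw [h, inv_pow, inv_eq_one] at hlab
        exact absurd hlab hδ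
    · have := main (stepRev s) hs (by simpa using h1)
      rwa [label_stepRev, inv_eq_one] at this
  · exact main s hs h2

/-- A near-balancing potential controls the gains of the closed walks through the base vertex. -/
theorem NearPotential.walkGain_mem {X : Subgraph G} {u : V} {δ : Γ} {p : V → Γ}
    (hX : NearPotential X u δ p) {L : List (E × Bool)} (hL : IsWalk G X L u u)
    (hint : ∀ x ∈ (L.map (stepEnd G)).dropLast, x ≠ u) :
    walkGain G L ∈ ({1, δ, δ⁻¹} : Set Γ) := by
  have key : ∀ L : List (E × Bool), ∀ w, w ≠ u → IsWalk G X L w u →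
      (∀ x ∈ (L.map (stepEnd G)).dropLast, x ≠ u) →
      p w * walkGain G L * (p u)⁻¹ = 1 ∨ p w * walkGain G L * (p u)⁻¹ = δ⁻¹ := by
    intro L
    induction L with
    | nil => rintro w hw ⟨rfl, -⟩; exact absurd rfl hw
    | cons s L ih =>
      rintro w hw ⟨hs, rfl, hL⟩ hint
      rw [walkGain_cons]
      cases L with
      | nil =>
        obtain ⟨h, -⟩ := hL
        have := (hX (stepRev s) hs).2.1 (by simpa using h) (by simpa using hw)
        rw [label_stepRev, inv_eq_one, inv_eq_iff_eq_inv, label, h] at this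
        simpa [walkGain_nil] using this
      | cons t L =>
        simp only [List.map_cons, List.dropLast_cons_cons, List.mem_cons,
          forall_eq_or_imp] at hint
        have hlab := (hX s hs).1 hw hint.1
        rw [label, mul_inv_eq_one] at hlab
        rw [← mul_assoc, hlab]
        exact ih _ hint.1 hL (by simpa using hint.2)
  simp only [Set.mem_insert_iff, Set.mem_singleton_iff]
  cases L with
  | nil => simp [walkGain_nil]
  | cons s L =>
    obtain ⟨hs, hsu, hL⟩ := hL
    rw [walkGain_cons]
    cases L with
    | nil =>
      have := (hX s hs).2.2 hsu hL.1
      rw [label_eq_gain (hsu.trans hL.1.symm)] at this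
      simpa [walkGain_nil] using this
    | cons t L =>
      simp only [List.map_cons, List.dropLast_cons_cons, List.mem_cons,
        forall_eq_or_imp] at hint
      have h1 := (hX s hs).2.1 hsu hint.1
      have h2 := key _ _ hint.1 hL (by simpa using hint.2)
      have e : stepGain G s * walkGain G (t :: L) =
          label G p s * (p (stepEnd G s) * walkGain G (t :: L) * (p u)⁻¹) := by
        rw [label, hsu]
        rw [mul_assoc (p (stepEnd G s)), ← mul_assoc _ (p (stepEnd G s)), inv_mul_cancel_right,
          mul_assoc, ← mul_assoc (stepGain G s), mul_left_comm, mul_inv_cancel, mul_one]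
      rw [e]
      rcases h1 with h1 | h1 <;> rcases h2 with h2 | h2 <;> simp [h1, h2]

theorem NearPotential.nearBalanced {X : Subgraph G} {u : V} {δ : Γ} {p : V → Γ}
    (hX : NearPotential X u δ p) (hu : u ∈ X.verts) (hfix : NoFixed G X)
    (hbal : ¬ PowBalanced 1 X) : NearBalanced G X :=
  ⟨hfix, u, hu, δ, by rwa [balanced_iff_powBalanced], fun _ h h' => hX.walkGain_mem h h'⟩

/-- The gains of the walks from `u` to `w` that never return to `u`. -/
def exitGains (X : Subgraph G) (u w : V) : Set Γ :=
  {g | ∃ L, IsWalk G X L u w ∧ (∀ x ∈ L.map (stepEnd G), x ≠ u) ∧ walkGain G L = g}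

theorem exitGains_nonempty {X : Subgraph G} {u w : V} (h : Reachable G X u w) :
    w ≠ u → (exitGains X u w).Nonempty := by
  intro hw
  obtain ⟨L, hL⟩ := h
  have key : ∀ L : List (E × Bool), ∀ x, IsWalk G X L x w →
      (exitGains X u w).Nonempty ∨ ∀ y ∈ L.map (stepEnd G), y ≠ u := by
    intro L
    induction L with
    | nil => intro x _; right; simp
    | cons s L ih =>
      rintro x ⟨hs, rfl, hL⟩
      rcases ih _ hL with h | h
      · exact Or.inl h
      · by_cases hy : stepEnd G s = u
        · exact Or.inl ⟨_, L, hy ▸ hL, h, rfl⟩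
        · right
          simpa [hy] using h
  rcases key L u hL with h | h
  exacts [h, ⟨_, L, hL, h, rfl⟩]

theorem exitGains_step {X : Subgraph G} {u : V} {s : E × Bool} (hs : s.1 ∈ X.edges)
    (h2 : stepEnd G s ≠ u) {a : Γ} (ha : a ∈ exitGains X u (stepStart G s)) :
    a * stepGain G s ∈ exitGains X u (stepEnd G s) := by
  obtain ⟨L, hL, hx, rfl⟩ := ha
  refine ⟨L ++ [s], hL.append (isWalk_single hs), ?_, ?_⟩
  · intro x hxm
    simp only [List.map_append, List.map_cons, List.map_nil, List.mem_append,
      List.mem_singleton] at hxm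
    rcases hxm with hxm | rfl
    exacts [hx x hxm, h2]
  · rw [walkGain_append, walkGain_cons, walkGain_nil, mul_one]

theorem exitGains_base {X : Subgraph G} {u : V} (hu : u ∈ X.verts) :
    (1 : Γ) ∈ exitGains X u u :=
  ⟨[], ⟨rfl, hu⟩, by simp, rfl⟩

theorem NearBalancedAt.exitGains_ratio {X : Subgraph G} {u w : V} {δ : Γ}
    (h : NearBalancedAt G X u δ) (hw : w ≠ u) {a b : Γ} (ha : a ∈ exitGains X u w)
    (hb : b ∈ exitGains X u w) : a = b ∨ a = b * δ ∨ a = b * δ⁻¹ := by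
  obtain ⟨L, hL, hLx, rfl⟩ := ha
  obtain ⟨M, hM, hMx, rfl⟩ := hb
  cases M with
  | nil => exact absurd hM.1.symm hw
  | cons s M =>
    obtain ⟨hs, hsu, hM⟩ := hM
    simp only [List.map_cons, List.mem_cons, forall_eq_or_imp] at hMx
    obtain ⟨M', hM', hg, hx⟩ := hM.exists_reverse (P := fun x => x ≠ u) hMx.1 hMx.2
    have hrev : IsWalk G X [stepRev s] (stepEnd G s) u := by
      have := isWalk_single (G := G) (H := X) (s := stepRev s) hs
      rwa [stepStart_stepRev, stepEnd_stepRev, hsu] at this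
    have := h.2 (L ++ M' ++ [stepRev s]) ((hL.append hM').append hrev) (by
      intro x hxm
      rw [List.map_append, List.map_cons, List.map_nil, List.dropLast_concat, List.map_append,
        List.mem_append] at hxm
      exact hxm.elim (hLx x) (hx x))
    rw [walkGain_append, walkGain_append, hg, walkGain_cons, walkGain_nil, mul_one,
      stepGain_stepRev, mul_assoc, ← mul_inv, mul_comm (walkGain G M), ← walkGain_cons] at this
    simp only [Set.mem_insert_iff, Set.mem_singleton_iff, mul_inv_eq_iff_eq_mul, one_mul] at this
    rwa [mul_comm δ, mul_comm δ⁻¹] at this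

theorem NearBalancedAt.loop_gain {X : Subgraph G} {u : V} {δ : Γ}
    (h : NearBalancedAt G X u δ) {s : E × Bool} (hs : s.1 ∈ X.edges)
    (h1 : stepStart G s = u) (h2 : stepEnd G s = u) :
    stepGain G s = 1 ∨ stepGain G s = δ ∨ stepGain G s = δ⁻¹ := by
  have := isWalk_single (G := G) (H := X) (s := s) hs
  rw [h1, h2] at this
  simpa [walkGain_cons, walkGain_nil] using h.2 [s] this (by simp)

/-- A potential for which all corrected gains are among `1`, `δ`, `δ⁻¹`. -/
theorem NearBalancedAt.exists_label_mem {X : Subgraph G} (hX : Connected G X) {u : V}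
    (hu : u ∈ X.verts) {δ : Γ} (h : NearBalancedAt G X u δ) :
    ∃ p : V → Γ, ∀ s : E × Bool, s.1 ∈ X.edges →
      label G p s = 1 ∨ label G p s = δ ∨ label G p s = δ⁻¹ := by
  have hne : ∀ w, ∃ g : Γ, w ∈ X.verts → w ≠ u → g ∈ exitGains X u w := by
    intro w
    by_cases hw : w ∈ X.verts ∧ w ≠ u
    · obtain ⟨g, hg⟩ := exitGains_nonempty (hX.2 u hu w hw.1) hw.2
      exact ⟨g, fun _ _ => hg⟩
    · exact ⟨1, fun a b => absurd ⟨a, b⟩ hw⟩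
  choose g hg using hne
  have hp : ∀ x ∈ X.verts, (if x = u then 1 else g x) ∈ exitGains X u x := by
    intro x hx
    split_ifs with hxu
    · rw [hxu]; exact exitGains_base hu
    · exact hg x hx hxu
  refine ⟨fun x => if x = u then 1 else g x, ?_⟩
  have main : ∀ s : E × Bool, s.1 ∈ X.edges → stepEnd G s ≠ u →
      label G (fun x => if x = u then 1 else g x) s = 1 ∨
      label G (fun x => if x = u then 1 else g x) s = δ ∨
      label G (fun x => if x = u then 1 else g x) s = δ⁻¹ := by
    intro s hs h2
    have := h.exitGains_ratio h2 (exitGains_step hs h2 (hp _ (stepStart_mem hs)))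
      (hp _ (stepEnd_mem hs))
    simpa only [label, mul_inv_eq_iff_eq_mul, one_mul, mul_comm δ, mul_comm δ⁻¹] using this
  intro s hs
  by_cases h2 : stepEnd G s = u
  · by_cases h1 : stepStart G s = u
    · rw [label_eq_gain (h1.trans h2.symm)]
      exact h.loop_gain hs h1 h2
    · have := main (stepRev s) hs (by simpa using h1)
      rw [label_stepRev, inv_eq_one, inv_eq_iff_eq_inv, inv_inj] at this
      tauto
  · exact main s hs h2

/-- A near-balanced connected subgraph whose gain has order at least `4` admits a
near-balancing potential. -/
theorem NearBalancedAt.exists_nearPotential {X : Subgraph G} (hX : Connected G X) {u : V}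
    (hu : u ∈ X.verts) {δ : Γ} (h : NearBalancedAt G X u δ) (hδ2 : δ ^ 2 ≠ 1)
    (hδ3 : δ ^ 3 ≠ 1) : ∃ p : V → Γ, NearPotential X u δ p := by
  have hδ1 : δ ≠ 1 := fun h => hδ2 (by simp [h])
  have hdd : δ * δ ≠ 1 := by rwa [← sq]
  let good : Set Γ → Γ → Prop := fun L c => L = {c} ∨ L = {c, c * δ}
  have hgood_uniq : ∀ L c c', good L c → good L c' → c = c' := by
    rintro L c c' (rfl | rfl) (h' | h')
    · simpa using h'
    · have h1 : c' ∈ ({c} : Set Γ) := h' ▸ by simp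
      have h2 : c' * δ ∈ ({c} : Set Γ) := h' ▸ by simp
      exact absurd (mul_eq_left.1 (h2.trans h1.symm)) hδ1
    · have h1 : c ∈ ({c'} : Set Γ) := h' ▸ by simp
      exact h1
    · have h1 : c ∈ ({c', c' * δ} : Set Γ) := h' ▸ by simp
      have h2 : c' ∈ ({c, c * δ} : Set Γ) := h' ▸ by simp
      rcases h1 with h1 | h1
      · exact h1
      · rcases h2 with h2 | h2
        · exact h2.symm
        · rw [Set.mem_singleton_iff] at h1 h2
          rw [h1, mul_assoc, left_eq_mul] at h2
          exact absurd h2 hdd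
  have hex : ∀ w ∈ X.verts, w ≠ u → ∃ c, good (exitGains X u w) c := by
    intro w hw hwu
    obtain ⟨a, ha⟩ := exitGains_nonempty (hX.2 u hu w hw) hwu
    by_cases h1 : a * δ ∈ exitGains X u w
    · refine ⟨a, Or.inr (Set.Subset.antisymm ?_ ?_)⟩
      · intro b hb
        rcases h.exitGains_ratio hwu hb ha with hba | hba | hba
        · simp [hba]
        · simp [hba]
        · exfalso
          rcases h.exitGains_ratio hwu h1 hb with h' | h' | h'
          · rw [hba, mul_left_cancel_iff, eq_inv_iff_mul_eq_one] at h'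
            exact hdd h'
          · rw [hba, mul_assoc, mul_left_cancel_iff, inv_mul_cancel] at h'
            exact hδ1 h'
          · rw [hba, mul_assoc, mul_left_cancel_iff, ← mul_inv, eq_inv_iff_mul_eq_one] at h'
            exact hδ3 (by rw [pow_succ, sq, mul_assoc]; exact h')
      · rintro b (rfl | rfl)
        exacts [ha, h1]
    · by_cases h2 : a * δ⁻¹ ∈ exitGains X u w
      · refine ⟨a * δ⁻¹, Or.inr (Set.Subset.antisymm ?_ ?_)⟩
        · intro b hb
          rcases h.exitGains_ratio hwu hb ha with rfl | rfl | rfl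
          · simp
          · exact absurd hb h1
          · simp
        · rintro b (rfl | rfl)
          exacts [h2, by simpa using ha]
      · refine ⟨a, Or.inl (Set.Subset.antisymm ?_ ?_)⟩
        · intro b hb
          rcases h.exitGains_ratio hwu hb ha with rfl | rfl | rfl
          · simp
          · exact absurd hb h1
          · exact absurd hb h2
        · rintro b rfl
          exact ha
  have hmem : ∀ L c, good L c → c ∈ L := by
    rintro L c (rfl | rfl) <;> simp
  have hex' : ∀ w, ∃ c, w ∈ X.verts → w ≠ u → good (exitGains X u w) c := by
    intro w
    by_cases hw : w ∈ X.verts ∧ w ≠ u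
    · obtain ⟨c, hc⟩ := hex w hw.1 hw.2
      exact ⟨c, fun _ _ => hc⟩
    · exact ⟨1, fun a b => absurd ⟨a, b⟩ hw⟩
  choose c hc using hex'
  refine ⟨fun x => if x = u then 1 else c x, fun s hs => ⟨fun h1 h2 => ?_, fun h1 h2 => ?_,
    fun h1 h2 => ?_⟩⟩
  · have hL : exitGains X u (stepEnd G s) =
        (fun a => a * stepGain G s) '' exitGains X u (stepStart G s) := by
      refine Set.Subset.antisymm ?_ ?_
      · intro b hb
        have := exitGains_step (s := stepRev s) (u := u) hs (by simpa using h1)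
          (by simpa using hb)
        exact ⟨_, by simpa using this, by simp⟩
      · rintro _ ⟨a, ha, rfl⟩
        exact exitGains_step hs h2 ha
    have hg1 := hc _ (stepStart_mem hs) h1
    have hg2 : good (exitGains X u (stepEnd G s)) (c (stepStart G s) * stepGain G s) := by
      rw [hL]
      rcases hg1 with h' | h'
      · left; rw [h']; simp
      · right; rw [h', Set.image_pair, mul_right_comm]
    have := hgood_uniq _ _ _ hg2 (hc _ (stepEnd_mem hs) h2)
    simp only [label, h1, h2, if_false, this, mul_inv_cancel]
  · have := exitGains_step hs h2 (by rw [h1]; exact exitGains_base hu)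
    rw [one_mul] at this
    simp only [label, h1, h2, if_true, if_false, one_mul]
    rcases hc _ (stepEnd_mem hs) h2 with h' | h' <;> rw [h'] at this
    · left
      rw [Set.mem_singleton_iff.1 this, mul_inv_cancel]
    · rcases this with h | h
      · left; rw [h, mul_inv_cancel]
      · right; rw [h]; simp
  · rw [label_eq_gain (h1.trans h2.symm)]
    exact h.loop_gain hs h1 h2

/-- No power `j - 1`, `j`, `j + 1` of the gain function is trivial on `X`. -/
def FullType (j : ℕ) (X : Subgraph G) : Prop :=
  ¬ PowBalanced (j - 1) X ∧ ¬ PowBalanced j X ∧ ¬ PowBalanced (j + 1) X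

theorem FullType.mono {j : ℕ} {X Y : Subgraph G} (h : X ≤ Y) (hX : FullType j X) :
    FullType j Y :=
  ⟨fun hY => hX.1 (hY.mono h), fun hY => hX.2.1 (hY.mono h), fun hY => hX.2.2 (hY.mono h)⟩

theorem FullType.not_powBalanced_one {j : ℕ} {X : Subgraph G} (hX : FullType j X) :
    ¬ PowBalanced 1 X := by
  rintro ⟨p, hp⟩
  refine hX.2.1 (PowBalanced.of_label_pow p fun s hs => ?_)
  have := hp s hs
  rw [pow_one] at this
  rw [label, this, mul_inv_cancel, one_pow]

theorem NearPotential.fullType {j : ℕ} {P X : Subgraph G} {u : V} {δ : Γ} {p : V → Γ}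
    (hX : NearPotential X u δ p) (hfull : FullType j X) (hPX : P ≤ X)
    (hP : ¬ PowBalanced 1 P) : FullType j P :=
  ⟨fun h => hP (hX.powBalanced_one hfull.1 hPX h), fun h => hP (hX.powBalanced_one hfull.2.1 hPX h),
    fun h => hP (hX.powBalanced_one hfull.2.2 hPX h)⟩

theorem FullType.exists_nearPotential {j : ℕ} (hj : 2 ≤ j) {X : Subgraph G}
    (hfull : FullType j X) (hX : Connected G X) (hnb : NearBalanced G X) :
    ∃ u ∈ X.verts, ∃ δ : Γ, ∃ p, δ ^ 2 ≠ 1 ∧ NearPotential X u δ p := by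
  obtain ⟨-, u, hu, δ, h⟩ := hnb
  obtain ⟨q, hq⟩ := h.exists_label_mem hX hu
  have hpow : ∀ c, δ ^ c = 1 → PowBalanced c X := fun c hc =>
    PowBalanced.of_label_pow q fun s hs => by
      rcases hq s ((freePart_le X).2 hs) with h | h | h <;> simp [h, hc]
  have hdvd : ∀ n c, n ∣ c → δ ^ n = 1 → PowBalanced c X := by
    rintro n c ⟨d, rfl⟩ hn
    exact hpow _ (by rw [pow_mul, hn, one_pow])
  have hδ2 : δ ^ 2 ≠ 1 := by
    intro h2
    rcases Nat.even_or_odd j with h' | h'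
    · exact hfull.2.1 (hdvd 2 j h'.two_dvd h2)
    · exact hfull.2.2 (hdvd 2 _ (h'.add_odd odd_one).two_dvd h2)
  have hδ3 : δ ^ 3 ≠ 1 := by
    intro h3
    have : 3 ∣ j - 1 ∨ 3 ∣ j ∨ 3 ∣ j + 1 := by omega
    rcases this with h' | h' | h'
    exacts [hfull.1 (hdvd _ _ h' h3), hfull.2.1 (hdvd _ _ h' h3), hfull.2.2 (hdvd _ _ h' h3)]
  obtain ⟨p, hp⟩ := h.exists_nearPotential hX hu hδ2 hδ3
  exact ⟨u, hu, δ, p, hδ2, hp⟩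

end NearBalanced

section RedAlpha

set_option linter.unusedSectionVars false

variable {V E : Type} [DecidableEq V] {k j : ℕ} [NeZero k]
  {G : GainedGraph V E (Multiplicative (ZMod k))} {X : Subgraph G}

theorem card_gainGroup_dvd (X : Subgraph G) : Nat.card (gainGroup G X) ∣ k := by
  have := Subgroup.card_subgroup_dvd_card (gainGroup G X)
  rwa [Nat.card_congr Multiplicative.toAdd, Nat.card_zmod] at this

theorem powBalanced_iff_dvd {c : ℕ} : PowBalanced c X ↔ Nat.card (gainGroup G X) ∣ c := by
  rw [powBalanced_iff, ← IsCyclic.exponent_eq_card, Monoid.exponent_dvd_iff_forall_pow_eq_one]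
  simp [Subtype.ext_iff]

theorem isZIso_iff {n : ℕ} : IsZIso G X n ↔ Nat.card (gainGroup G X) = n := by
  constructor
  · rintro ⟨e⟩
    rw [Nat.card_congr e.toEquiv, Nat.card_congr Multiplicative.toAdd, Nat.card_zmod]
  · intro h
    refine ⟨mulEquivOfCyclicCardEq ?_⟩
    rw [h, Nat.card_congr Multiplicative.toAdd, Nat.card_zmod]

theorem isS_iff {i : ℤ} : IsS G k j i X ↔ 2 ≤ Nat.card (gainGroup G X) ∧
    (Odd j → Nat.card (gainGroup G X) ≠ 2) ∧ (Nat.card (gainGroup G X) : ℤ) ∣ i - j := by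
  have key : ∀ n : ℕ, ((j : ZMod n) = (i : ZMod n)) ↔ (n : ℤ) ∣ i - j := by
    intro n
    rw [← ZMod.intCast_eq_intCast_iff_dvd_sub, Int.cast_natCast]
  simp only [IsS, SSet, Set.mem_ofPred_eq, isZIso_iff, key]
  constructor
  · rintro ⟨n, ⟨h1, -, h2, h3⟩, rfl⟩
    exact ⟨h1, h2, h3⟩
  · rintro ⟨h1, h2, h3⟩
    exact ⟨_, ⟨h1, card_gainGroup_dvd X, h2, h3⟩, rfl⟩

/-- The value of `alpha` corrected so that every fixed vertex is discounted from the count. -/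
noncomputable def redAlpha (k j : ℕ) {G : GainedGraph V E (Multiplicative (ZMod k))}
    (X : Subgraph G) : ℤ :=
  alpha G k j X + 2 * (X.fixedVerts.card : ℤ)

theorem isS_neg_one_iff : IsS G k j (-1) X ↔ 2 ≤ Nat.card (gainGroup G X) ∧
    (Odd j → Nat.card (gainGroup G X) ≠ 2) ∧ Nat.card (gainGroup G X) ∣ j + 1 := by
  rw [isS_iff, ← Int.natCast_dvd_natCast, ← dvd_neg]
  congr! 3
  push_cast
  ring

theorem isS_one_iff (hj : 2 ≤ j) : IsS G k j 1 X ↔ 2 ≤ Nat.card (gainGroup G X) ∧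
    (Odd j → Nat.card (gainGroup G X) ≠ 2) ∧ Nat.card (gainGroup G X) ∣ j - 1 := by
  rw [isS_iff, ← Int.natCast_dvd_natCast, ← dvd_neg]
  congr! 3
  omega

theorem isS_zero_iff : IsS G k j 0 X ↔ 2 ≤ Nat.card (gainGroup G X) ∧
    (Odd j → Nat.card (gainGroup G X) ≠ 2) ∧ Nat.card (gainGroup G X) ∣ j := by
  rw [isS_iff, ← Int.natCast_dvd_natCast, ← dvd_neg]
  congr! 3
  omega

theorem redAlpha_of_free (hj : 2 ≤ j) (h : X.fixedVerts.card = 0) :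
    redAlpha k j X = if FullType j X ∧ NearBalanced G X then 2 else
      (if PowBalanced (j - 1) X then 0 else 1) + (if PowBalanced j X then 0 else 1) +
        (if PowBalanced (j + 1) X then 0 else 1) := by
  have hN : 0 < Nat.card (gainGroup G X) := Nat.card_pos
  simp only [redAlpha, alpha, FullType, IsSpm, ProperNearBalanced, h, balanced_iff_powBalanced,
    powBalanced_iff_dvd, isZIso_iff, isS_neg_one_iff, isS_one_iff hj, isS_zero_iff, Nat.dvd_one]
  generalize Nat.card (gainGroup G X) = N at hN
  have h1 : N ∣ j - 1 → N ∣ j → N = 1 := fun a b => by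
    have := (Nat.dvd_sub b a); rwa [show j - (j - 1) = 1 by omega, Nat.dvd_one] at this
  have h2 : N ∣ j → N ∣ j + 1 → N = 1 := fun a b => by
    have := (Nat.dvd_sub b a); rwa [show j + 1 - j = 1 by omega, Nat.dvd_one] at this
  have h3 : N ∣ j - 1 → N ∣ j + 1 → N ≤ 2 := fun a b => by
    have := (Nat.dvd_sub b a)
    rw [show j + 1 - (j - 1) = 2 by omega] at this
    exact Nat.le_of_dvd two_pos this
  by_cases hN1 : N = 1
  · subst hN1; simp
  by_cases hN2 : N = 2
  · subst hN2
    rcases Nat.even_or_odd j with hp | hp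
    · have a1 : ¬ 2 ∣ j - 1 := by have := hp.two_dvd; omega
      have a2 : ¬ 2 ∣ j + 1 := by have := hp.two_dvd; omega
      simp [hp.two_dvd, a1, a2, Nat.not_odd_iff_even.2 hp]
    · have hp' : j % 2 = 1 := Nat.odd_iff.1 hp
      have a1 : 2 ∣ j - 1 := by omega
      have a2 : 2 ∣ j + 1 := by omega
      have a3 : ¬ 2 ∣ j := by omega
      simp [hp, a1, a2, a3]
  have hN3 : N = 3 → N ∣ j - 1 ∨ N ∣ j ∨ N ∣ j + 1 := by rintro rfl; omega
  have hN2' : 2 ≤ N := by omega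
  have h3' : N ∣ j - 1 → ¬ N ∣ j + 1 := fun a b => by have := h3 a b; omega
  by_cases a1 : N ∣ j - 1
  · have a2 : ¬ N ∣ j := fun a2 => hN1 (h1 a1 a2)
    have a3 := h3' a1
    simp [hN1, hN2, hN2', a1, a2, a3]
  by_cases a2 : N ∣ j
  · have a3 : ¬ N ∣ j + 1 := fun a3 => hN1 (h2 a2 a3)
    simp [hN1, hN2, hN2', a1, a2, a3]
  by_cases a3 : N ∣ j + 1
  · simp [hN1, hN2, hN2', a1, a2, a3]
  have hN3' : N ≠ 3 := fun h => by
    rcases hN3 h with h | h | h <;> contradiction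
  by_cases hnb : NearBalanced G X <;> simp [hN1, hN2, hN3', a1, a2, a3, hnb]

theorem redAlpha_of_fixed (hj : 2 ≤ j) (h : X.fixedVerts.card = 1) :
    redAlpha k j X = 2 + (if PowBalanced j X then 0 else 1) := by
  have hN : 0 < Nat.card (gainGroup G X) := Nat.card_pos
  simp only [redAlpha, alpha, IsSpm, ProperNearBalanced, h, balanced_iff_powBalanced,
    powBalanced_iff_dvd, isZIso_iff, isS_neg_one_iff, isS_one_iff hj, isS_zero_iff, Nat.dvd_one]
  generalize Nat.card (gainGroup G X) = N at hN
  have h1 : N ∣ j - 1 → N ∣ j → N = 1 := fun a b => by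
    have := (Nat.dvd_sub b a); rwa [show j - (j - 1) = 1 by omega, Nat.dvd_one] at this
  have h2 : N ∣ j → N ∣ j + 1 → N = 1 := fun a b => by
    have := (Nat.dvd_sub b a); rwa [show j + 1 - j = 1 by omega, Nat.dvd_one] at this
  by_cases hN1 : N = 1
  · subst hN1; simp
  by_cases hN2 : N = 2
  · subst hN2
    rcases Nat.even_or_odd j with hp | hp
    · have a1 : ¬ 2 ∣ j - 1 := by have := hp.two_dvd; omega
      have a2 : ¬ 2 ∣ j + 1 := by have := hp.two_dvd; omega
      simp [hp.two_dvd, a1, a2, Nat.not_odd_iff_even.2 hp]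
    · have hp' : j % 2 = 1 := Nat.odd_iff.1 hp
      have a3 : ¬ 2 ∣ j := by omega
      simp [hp, a3]
  have hN2' : 2 ≤ N := by omega
  by_cases a2 : N ∣ j
  · have a1 : ¬ N ∣ j - 1 := fun a1 => hN1 (h1 a1 a2)
    have a3 : ¬ N ∣ j + 1 := fun a3 => hN1 (h2 a2 a3)
    simp [hN1, hN2, hN2', a1, a2, a3]
  · by_cases a1 : N ∣ j - 1 <;> by_cases a3 : N ∣ j + 1 <;>
      simp [hN1, hN2, hN2', a1, a2, a3]

end RedAlpha

section Monotone

set_option linter.unusedSectionVars false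

variable {V E : Type} [DecidableEq V] {k j : ℕ} [NeZero k]
  {G : GainedGraph V E (Multiplicative (ZMod k))} {X : Subgraph G}

theorem noFixed_iff_card {Γ : Type} {G : GainedGraph V E Γ} {X : Subgraph G} :
    NoFixed G X ↔ X.fixedVerts.card = 0 := by
  rw [Finset.card_eq_zero, Subgraph.fixedVerts, ← Finset.disjoint_iff_inter_eq_empty,
    Finset.disjoint_left]
  rfl

theorem NoFixed.mono {Γ : Type} {G : GainedGraph V E Γ} {X Y : Subgraph G} (h : X ≤ Y)
    (hY : NoFixed G Y) : NoFixed G X :=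
  fun x hx => hY x (h.1 hx)

theorem card_verts_eq {Γ : Type} {G : GainedGraph V E Γ} (X : Subgraph G) :
    (X.verts.card : ℤ) = X.freeVerts.card + X.fixedVerts.card := by
  rw [Subgraph.freeVerts, Subgraph.fixedVerts]
  exact_mod_cast (Finset.card_sdiff_add_card_inter _ _).symm

/-- The part of `redAlpha` that ignores near-balancedness. -/
noncomputable def alphaSum (j : ℕ) (X : Subgraph G) : ℤ :=
  (if PowBalanced (j - 1) X ∧ NoFixed G X then 0 else 1) + (if PowBalanced j X then 0 else 1) +
    (if PowBalanced (j + 1) X ∧ NoFixed G X then 0 else 1)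

theorem redAlpha_of_nearBalanced (hj : 2 ≤ j) (hfull : FullType j X) (h : NearBalanced G X) :
    redAlpha k j X = 2 := by
  rw [redAlpha_of_free hj (noFixed_iff_card.1 h.1), if_pos ⟨hfull, h⟩]

theorem redAlpha_of_not (hj : 2 ≤ j) (hX : X.fixedVerts.card ≤ 1)
    (h : ¬ (FullType j X ∧ NearBalanced G X)) : redAlpha k j X = alphaSum j X := by
  by_cases hf : NoFixed G X
  · rw [redAlpha_of_free hj (noFixed_iff_card.1 hf), if_neg h, alphaSum]
    simp only [hf, and_true]
  · have h1 : X.fixedVerts.card = 1 := by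
      have := mt noFixed_iff_card.2 hf
      omega
    rw [redAlpha_of_fixed hj h1, alphaSum]
    simp only [hf, and_false, if_false]
    ring

theorem FullType.alphaSum_eq (h : FullType j X) : alphaSum j X = 3 := by
  simp [alphaSum, h.1, h.2.1, h.2.2]

theorem redAlpha_le_alphaSum (hj : 2 ≤ j) (hX : X.fixedVerts.card ≤ 1) :
    redAlpha k j X ≤ alphaSum j X := by
  by_cases h : FullType j X ∧ NearBalanced G X
  · rw [redAlpha_of_nearBalanced hj h.1 h.2, h.1.alphaSum_eq]; norm_num
  · rw [redAlpha_of_not hj hX h]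

theorem alphaSum_nonneg : 0 ≤ alphaSum j X := by
  unfold alphaSum; split_ifs <;> norm_num

theorem alphaSum_le_three : alphaSum j X ≤ 3 := by
  unfold alphaSum; split_ifs <;> norm_num

theorem redAlpha_le_three (hj : 2 ≤ j) (hX : X.fixedVerts.card ≤ 1) : redAlpha k j X ≤ 3 :=
  (redAlpha_le_alphaSum hj hX).trans alphaSum_le_three

theorem redAlpha_nonneg (hj : 2 ≤ j) (hX : X.fixedVerts.card ≤ 1) : 0 ≤ redAlpha k j X := by
  by_cases h : FullType j X ∧ NearBalanced G X
  · rw [redAlpha_of_nearBalanced hj h.1 h.2]; norm_num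
  · rw [redAlpha_of_not hj hX h]; exact alphaSum_nonneg

theorem alphaSum_mono {P : Subgraph G} (h : P ≤ X) : alphaSum j P ≤ alphaSum j X := by
  have h1 : ∀ c, PowBalanced c X → PowBalanced c P := fun c => PowBalanced.mono h
  have h2 : NoFixed G X → NoFixed G P := NoFixed.mono h
  have key : ∀ (p q : Prop) [Decidable p] [Decidable q], (q → p) →
      (if p then (0 : ℤ) else 1) ≤ if q then 0 else 1 := by
    intro p q _ _ hpq
    by_cases hq : q
    · simp [hq, hpq hq]
    · by_cases hp : p <;> simp [hp, hq]
  unfold alphaSum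
  exact add_le_add (add_le_add (key _ _ fun h => ⟨h1 _ h.1, h2 h.2⟩) (key _ _ (h1 _)))
    (key _ _ fun h => ⟨h1 _ h.1, h2 h.2⟩)

theorem PowBalanced.of_one {c : ℕ} (h : PowBalanced 1 X) : PowBalanced c X := by
  rw [powBalanced_iff_dvd] at *
  exact h.trans (one_dvd _)

theorem redAlpha_eq_zero_iff (hj : 2 ≤ j) (hX : X.fixedVerts.card ≤ 1) :
    redAlpha k j X = 0 ↔ PowBalanced 1 X ∧ NoFixed G X := by
  by_cases h : FullType j X ∧ NearBalanced G X
  · rw [redAlpha_of_nearBalanced hj h.1 h.2]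
    simp [h.1.not_powBalanced_one]
  · rw [redAlpha_of_not hj hX h]
    constructor
    · intro h0
      unfold alphaSum at h0
      split_ifs at h0 with h1 h2 h3
      · exact ⟨h2.one_of_succ h3.1, h3.2⟩
      all_goals norm_num at h0
    · rintro ⟨h1, h2⟩
      simp [alphaSum, h1.of_one, h2]

theorem fullType_of_alphaSum (hX : NoFixed G X) (h : alphaSum j X = 3) : FullType j X := by
  simp only [alphaSum, hX, and_true] at h
  refine ⟨fun h1 => ?_, fun h1 => ?_, fun h1 => ?_⟩ <;> rw [if_pos h1] at h <;>
    split_ifs at h <;> norm_num at h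

theorem NearPotential.mono {Γ : Type} [CommGroup Γ] {G : GainedGraph V E Γ} {X P : Subgraph G}
    {u : V} {δ : Γ} {p : V → Γ} (hX : NearPotential X u δ p) (h : P ≤ X) :
    NearPotential P u δ p :=
  fun s hs => hX s (h.2 hs)

theorem NearPotential.redAlpha_le (hj : 2 ≤ j) {u : V} {δ : Multiplicative (ZMod k)}
    {p : V → Multiplicative (ZMod k)} (hX : NearPotential X u δ p) (hfix : NoFixed G X) :
    redAlpha k j X ≤ 2 := by
  by_cases hfull : FullType j X
  · have hu : u ∈ X.verts := by
      by_contra hu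
      exact hfull.not_powBalanced_one (hX.powBalanced_of_notMem ⟨subset_rfl, subset_rfl⟩ hu)
    rw [redAlpha_of_nearBalanced hj hfull
      (hX.nearBalanced hu hfix hfull.not_powBalanced_one)]
  · have h0 := noFixed_iff_card.1 hfix
    have h1 := redAlpha_le_alphaSum (k := k) hj (h0.trans_le zero_le_one)
    have h2 := alphaSum_le_three (j := j) (X := X)
    have h3 := mt (fullType_of_alphaSum (j := j) hfix) hfull
    omega

theorem redAlpha_mono (hj : 2 ≤ j) {P : Subgraph G} (h : P ≤ X) (hX : X.fixedVerts.card ≤ 1)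
    (hconn : Connected G X) : redAlpha k j P ≤ redAlpha k j X := by
  have hP : P.fixedVerts.card ≤ 1 :=
    (Finset.card_le_card (Finset.inter_subset_inter_right h.1)).trans hX
  by_cases hnb : FullType j X ∧ NearBalanced G X
  · rw [redAlpha_of_nearBalanced hj hnb.1 hnb.2]
    obtain ⟨u, -, δ, p, -, hp⟩ := hnb.1.exists_nearPotential hj hconn hnb.2
    exact (hp.mono h).redAlpha_le hj (hnb.2.1.mono h)
  · rw [redAlpha_of_not hj hX hnb]
    exact (redAlpha_le_alphaSum hj hP).trans (alphaSum_mono h)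

end Monotone

section Pieces

set_option linter.unusedSectionVars false

variable {V E Γ : Type} [DecidableEq V] {G : GainedGraph V E Γ}

/-- The component of the free part of `F` containing `w`, together with all its incident edges,
splits off from `F`. -/
theorem exists_piece {F : Subgraph G}
    {w : V} (hw : w ∈ F.freeVerts) : ∃ P R : Subgraph G, P ≤ F ∧ R ≤ F ∧ Connected G P ∧
      w ∈ P.freeVerts ∧ (∀ x ∈ P.freeVerts, Reachable G (freePart P) w x) ∧
      (∀ e ∈ F.edges, G.tail e = w ∨ G.head e = w → e ∈ P.edges) ∧
      P.edges.card + R.edges.card = F.edges.card ∧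
      (∀ e ∈ F.edges, e ∈ P.edges ∨ e ∈ R.edges) ∧
      Disjoint P.freeVerts R.freeVerts ∧ P.freeVerts ∪ R.freeVerts = F.freeVerts := by
  set A : Finset V := F.freeVerts.filter fun x => Reachable G (freePart F) w x with hA
  have hAF : A ⊆ F.freeVerts := Finset.filter_subset _ _
  have hwA : w ∈ A := Finset.mem_filter.2 ⟨hw, .refl hw⟩
  have hstep : ∀ s : E × Bool, s.1 ∈ F.edges → stepStart G s ∈ A →
      stepEnd G s ∉ G.fixed → stepEnd G s ∈ A := by
    intro s hs h1 h2
    have hs' : s.1 ∈ (freePart F).edges :=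
      mem_freePart_edges.2 ⟨hs, (Finset.mem_sdiff.1 (hAF h1)).2, h2⟩
    exact Finset.mem_filter.2 ⟨Finset.mem_sdiff.2 ⟨stepEnd_mem hs, h2⟩,
      (Finset.mem_filter.1 h1).2.trans (.step hs')⟩
  let P : Subgraph G :=
    { verts := F.verts.filter fun x => x ∈ A ∨
        ∃ s : E × Bool, s.1 ∈ F.edges ∧ stepStart G s ∈ A ∧ stepEnd G s = x
      edges := F.edges.filter fun e => G.tail e ∈ A ∨ G.head e ∈ A
      tail_mem := by
        intro e he
        obtain ⟨he, h⟩ := Finset.mem_filter.1 he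
        exact Finset.mem_filter.2 ⟨F.tail_mem e he, h.imp id fun h => ⟨(e, false), he, h, rfl⟩⟩
      head_mem := by
        intro e he
        obtain ⟨he, h⟩ := Finset.mem_filter.1 he
        exact Finset.mem_filter.2
          ⟨F.head_mem e he, h.symm.imp id fun h => ⟨(e, true), he, h, rfl⟩⟩ }
  let R : Subgraph G :=
    { verts := F.verts \ A
      edges := F.edges.filter fun e => ¬ (G.tail e ∈ A ∨ G.head e ∈ A)
      tail_mem := by
        intro e he
        obtain ⟨he, h⟩ := Finset.mem_filter.1 he
        exact Finset.mem_sdiff.2 ⟨F.tail_mem e he, fun h' => h (Or.inl h')⟩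
      head_mem := by
        intro e he
        obtain ⟨he, h⟩ := Finset.mem_filter.1 he
        exact Finset.mem_sdiff.2 ⟨F.head_mem e he, fun h' => h (Or.inr h')⟩ }
  have hPF : P ≤ F := ⟨Finset.filter_subset _ _, Finset.filter_subset _ _⟩
  have hRF : R ≤ F := ⟨Finset.sdiff_subset, Finset.filter_subset _ _⟩
  have hPfree : P.freeVerts = A := by
    ext x
    constructor
    · intro hx
      obtain ⟨hxP, hxf⟩ := Finset.mem_sdiff.1 hx
      rcases (Finset.mem_filter.1 hxP).2 with h | ⟨s, hs, h1, rfl⟩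
      exacts [h, hstep s hs h1 hxf]
    · intro hx
      have := Finset.mem_sdiff.1 (hAF hx)
      exact Finset.mem_sdiff.2 ⟨Finset.mem_filter.2 ⟨this.1, Or.inl hx⟩, this.2⟩
  have hPedge : ∀ s : E × Bool, s.1 ∈ F.edges → stepStart G s ∈ A → s.1 ∈ P.edges := by
    intro s hs h
    refine Finset.mem_filter.2 ⟨hs, ?_⟩
    rcases stepStart_eq_or (G := G) s with h' | h'
    · exact Or.inl (h'.1 ▸ h)
    · exact Or.inr (h'.1 ▸ h)
  have hreach : ∀ x ∈ P.freeVerts, Reachable G (freePart P) w x := by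
    intro x hx
    rw [hPfree, hA, Finset.mem_filter] at hx
    refine hx.2.induct (P := Reachable G (freePart P) w) ?_ (.refl (show w ∈ P.freeVerts from hPfree.symm ▸ hwA))
    intro s hs h
    have hsA : stepStart G s ∈ A := by
      obtain ⟨L, hL⟩ := h
      rw [← hPfree]
      exact hL.mem_right
    obtain ⟨h1, h2, h3⟩ := mem_freePart_edges.1 hs
    exact h.trans (.step (mem_freePart_edges.2 ⟨hPedge s h1 hsA, h2, h3⟩))
  have hconn : ∀ x ∈ P.verts, Reachable G P w x := by
    intro x hx
    rcases (Finset.mem_filter.1 hx).2 with h | ⟨s, hs, h1, rfl⟩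
    · exact (hreach x (hPfree.symm ▸ h)).mono (freePart_le P)
    · exact ((hreach _ (hPfree.symm ▸ h1)).mono (freePart_le P)).trans (.step (hPedge s hs h1))
  refine ⟨P, R, hPF, hRF, ⟨⟨w, (Finset.mem_sdiff.1 (hPfree.symm ▸ hwA)).1⟩, fun x hx y hy =>
    (hconn x hx).symm.trans (hconn y hy)⟩, hPfree.symm ▸ hwA, hreach, ?_, ?_, ?_, ?_, ?_⟩
  · rintro e he (h | h)
    · exact Finset.mem_filter.2 ⟨he, Or.inl (h ▸ hwA)⟩
    · exact Finset.mem_filter.2 ⟨he, Or.inr (h ▸ hwA)⟩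
  · exact Finset.card_filter_add_card_filter_not _
  · intro e he
    by_cases h : G.tail e ∈ A ∨ G.head e ∈ A
    · exact Or.inl (Finset.mem_filter.2 ⟨he, h⟩)
    · exact Or.inr (Finset.mem_filter.2 ⟨he, h⟩)
  · rw [hPfree, Finset.disjoint_left]
    intro x hx hxR
    exact (Finset.mem_sdiff.1 (Finset.mem_sdiff.1 hxR).1).2 hx
  · rw [hPfree]
    ext x
    have := @hAF x
    simp only [Subgraph.freeVerts, Finset.mem_union, Finset.mem_sdiff, R] at this ⊢
    tauto

end Pieces

section Counting

set_option linter.unusedSectionVars false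

variable {V E : Type} [DecidableEq V] {k j : ℕ} [NeZero k]
  {G : GainedGraph V E (Multiplicative (ZMod k))} {G₀ : Subgraph G}

/-- Sparsity of the connected subgraphs, in terms of free vertices only. -/
structure CountSparse (k j : ℕ) {G : GainedGraph V E (Multiplicative (ZMod k))}
    (G₀ : Subgraph G) : Prop where
  fixed_card : G₀.fixedVerts.card ≤ 1
  free_end : ∀ e ∈ G₀.edges, ∃ s : E × Bool, s.1 = e ∧ stepStart G s ∉ G.fixed
  count : ∀ K ≤ G₀, K.edges.Nonempty → Connected G K →
    (K.edges.card : ℤ) ≤ 2 * (K.freeVerts.card : ℤ) - 3 + redAlpha k j K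

theorem GainSparseKJ.countSparse (hG₀ : IsGainGraphOn G G₀) (h : GainSparseKJ G k j G₀) :
    CountSparse k j G₀ where
  fixed_card := hG₀.fixed_card
  free_end e he := by
    by_cases ht : G.tail e ∈ G.fixed
    · refine ⟨(e, false), rfl, fun hh => ?_⟩
      have h1 : G.tail e ∈ G₀.fixedVerts := Finset.mem_inter.2 ⟨G₀.tail_mem e he, ht⟩
      have h2 : G.head e ∈ G₀.fixedVerts := Finset.mem_inter.2 ⟨G₀.head_mem e he, hh⟩
      exact hG₀.fixed_not_loop e he (Finset.card_le_one.1 hG₀.fixed_card _ h1 _ h2) ht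
    · exact ⟨(e, true), rfl, ht⟩
  count K hK hE hconn := by
    have hspan : edgeSpan G K.edges = K := by
      refine Subgraph.ext_sets ?_ rfl
      ext x
      simp only [edgeSpan, Finset.mem_union, Finset.mem_image]
      constructor
      · rintro (⟨e, he, rfl⟩ | ⟨e, he, rfl⟩)
        exacts [K.tail_mem e he, K.head_mem e he]
      · intro hx
        obtain ⟨s, hs, rfl⟩ := hconn.exists_incident hE hx
        rcases stepStart_eq_or (G := G) s with h' | h'
        · exact Or.inl ⟨_, hs, h'.1.symm⟩
        · exact Or.inr ⟨_, hs, h'.1.symm⟩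
    have hcomp : ∀ e ∈ K.edges, componentOf G K.edges e = K := by
      intro e he
      rw [componentOf, Finset.filter_true_of_mem, hspan]
      intro f hf
      rw [hspan]
      exact hconn.2 _ (K.tail_mem e he) _ (K.tail_mem f hf)
    have hcomps : components G K.edges = {K} := by
      rw [components, Finset.image_congr (g := fun _ => K) (fun e he => hcomp e he),
        Finset.image_const hE]
    have := h K hK hE
    rw [fCount, hcomps, Finset.sum_singleton, card_verts_eq] at this
    rw [redAlpha]
    linarith

theorem CountSparse.fixed_card_of_le (hj : 2 ≤ j) (hG₀ : CountSparse k j G₀)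
    {F : Subgraph G} (hF : F ≤ G₀) :
    F.fixedVerts.card ≤ 1 :=
  (Finset.card_le_card (Finset.inter_subset_inter_right hF.1)).trans hG₀.fixed_card

theorem CountSparse.exists_free_start (hj : 2 ≤ j) (hG₀ : CountSparse k j G₀)
    {F : Subgraph G} (hF : F ≤ G₀) (hE : F.edges.Nonempty) :
    ∃ s : E × Bool, s.1 ∈ F.edges ∧ stepStart G s ∈ F.freeVerts := by
  obtain ⟨e, he⟩ := hE
  obtain ⟨s, rfl, hs⟩ := hG₀.free_end e (hF.2 he)
  exact ⟨s, he, Finset.mem_sdiff.2 ⟨stepStart_mem he, hs⟩⟩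

/-- Splitting off a connected piece containing an edge. -/
theorem CountSparse.exists_piece (hj : 2 ≤ j) (hG₀ : CountSparse k j G₀)
    {F : Subgraph G} (hF : F ≤ G₀) (hE : F.edges.Nonempty) :
    ∃ (w : V) (P R : Subgraph G), P ≤ F ∧ R ≤ F ∧ Connected G P ∧ P.edges.Nonempty ∧
      w ∈ P.freeVerts ∧ (∀ x ∈ P.freeVerts, Reachable G (freePart P) w x) ∧
      P.edges.card + R.edges.card = F.edges.card ∧
      P.freeVerts.card + R.freeVerts.card = F.freeVerts.card ∧
      (∀ e ∈ F.edges, e ∈ P.edges ∨ e ∈ R.edges) ∧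
      Disjoint P.freeVerts R.freeVerts ∧ P.freeVerts ∪ R.freeVerts = F.freeVerts := by
  obtain ⟨s, hs, hw⟩ := hG₀.exists_free_start hj hF hE
  obtain ⟨P, R, h1, h2, h3, h4, h5, h6, h7, h8, h9, h10⟩ := GR.exists_piece hw
  refine ⟨_, P, R, h1, h2, h3, ⟨s.1, h6 _ hs ?_⟩, h4, h5, h7, ?_, h8, h9, h10⟩
  · rcases stepStart_eq_or (G := G) s with h' | h'
    · exact Or.inl h'.1.symm
    · exact Or.inr h'.1.symm
  · rw [← h10, Finset.card_union_of_disjoint h9]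

theorem CountSparse.card_edges_le_two_mul (hj : 2 ≤ j) (hG₀ : CountSparse k j G₀)
    {F : Subgraph G} (hF : F ≤ G₀) :
    F.edges.card ≤ 2 * F.freeVerts.card := by
  induction hn : F.freeVerts.card using Nat.strong_induction_on generalizing F with
  | _ n ih =>
    subst hn
    by_cases hE : F.edges.Nonempty
    · obtain ⟨w, P, R, hP, hR, hPc, hPE, hw, -, hcE, hcV, -⟩ := hG₀.exists_piece hj hF hE
      have hPG : P ≤ G₀ := ⟨hP.1.trans hF.1, hP.2.trans hF.2⟩
      have h1 := hG₀.count P hPG hPE hPc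
      have h2 := redAlpha_le_three (k := k) hj (hG₀.fixed_card_of_le hj hPG)
      have h3 : 0 < P.freeVerts.card := Finset.card_pos.2 ⟨w, hw⟩
      have h4 := ih R.freeVerts.card (by omega)
        (F := R) ⟨hR.1.trans hF.1, hR.2.trans hF.2⟩ rfl
      omega
    · rw [Finset.not_nonempty_iff_eq_empty] at hE
      simp [hE]

theorem CountSparse.card_edges_le_of_forall (hj : 2 ≤ j) (hG₀ : CountSparse k j G₀)
    {F : Subgraph G} (hF : F ≤ G₀)
    (hE : F.edges.Nonempty) {c : ℤ}
    (hc : ∀ P ≤ F, redAlpha k j P ≤ c) :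
    (F.edges.card : ℤ) ≤ 2 * (F.freeVerts.card : ℤ) - 3 + c := by
  obtain ⟨w, P, R, hP, hR, hPc, hPE, hw, -, hcE, hcV, -⟩ := hG₀.exists_piece hj hF hE
  have h1 := hG₀.count P ⟨hP.1.trans hF.1, hP.2.trans hF.2⟩ hPE hPc
  have h2 := hc P hP
  have h4 := hG₀.card_edges_le_two_mul hj (F := R) ⟨hR.1.trans hF.1, hR.2.trans hF.2⟩
  omega

theorem CountSparse.card_edges_le_of_le (hj : 2 ≤ j) (hG₀ : CountSparse k j G₀)
    {F X : Subgraph G} (hF : F ≤ G₀)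
    (hE : F.edges.Nonempty) (hFX : F ≤ X) (hX : X.fixedVerts.card ≤ 1) (hXc : Connected G X) :
    (F.edges.card : ℤ) ≤ 2 * (F.freeVerts.card : ℤ) - 3 + redAlpha k j X :=
  hG₀.card_edges_le_of_forall hj hF hE fun _ hP =>
    redAlpha_mono hj ⟨hP.1.trans hFX.1, hP.2.trans hFX.2⟩ hX hXc

theorem CountSparse.card_edges_le_of_balanced (hj : 2 ≤ j) (hG₀ : CountSparse k j G₀)
    {F : Subgraph G} (hF : F ≤ G₀)
    (hE : F.edges.Nonempty) (hb : PowBalanced 1 F) (hfix : NoFixed G F) :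
    (F.edges.card : ℤ) ≤ 2 * (F.freeVerts.card : ℤ) - 3 := by
  have := hG₀.card_edges_le_of_forall hj hF hE (c := 0) fun _ hP =>
    ((redAlpha_eq_zero_iff hj
      (hG₀.fixed_card_of_le hj ⟨hP.1.trans hF.1, hP.2.trans hF.2⟩)).2
        ⟨hb.mono hP, hfix.mono hP⟩).le
  linarith

end Counting

section Ratio

set_option linter.unusedSectionVars false

variable {V E Γ : Type} [DecidableEq V] [CommGroup Γ] {G : GainedGraph V E Γ}

/-- The ratio of two potentials. -/
def ratio (p q : V → Γ) (x : V) : Γ := q x * (p x)⁻¹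

theorem label_eq_ratio (p q : V → Γ) (s : E × Bool) :
    label G q s = ratio p q (stepStart G s) * (ratio p q (stepEnd G s))⁻¹ * label G p s := by
  rw [← label_mul p]
  congr 1
  funext x
  rw [ratio, mul_comm, inv_mul_cancel_right]

theorem ratio_eq_of_label_eq {p q : V → Γ} {s : E × Bool} (h : label G q s = label G p s) :
    ratio p q (stepEnd G s) = ratio p q (stepStart G s) := by
  rw [label_eq_ratio p q, mul_eq_right, mul_inv_eq_one] at h
  exact h.symm

theorem ratio_eq_of_label_right {p q : V → Γ} {s : E × Bool} (h : label G q s = 1) :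
    ratio p q (stepEnd G s) = ratio p q (stepStart G s) * label G p s := by
  rw [label_eq_ratio p q, mul_right_comm, mul_inv_eq_one] at h
  exact h.symm

theorem ratio_eq_of_reachable {F : Subgraph G} {p q : V → Γ}
    (h : ∀ s : E × Bool, s.1 ∈ F.edges → label G q s = label G p s) {w x : V}
    (hx : Reachable G F w x) : ratio p q x = ratio p q w := by
  refine hx.induct (P := fun x => ratio p q x = ratio p q w) ?_ rfl
  intro s hs h'
  rw [ratio_eq_of_label_eq (h s hs), h']

theorem label_forall_of_true {c : E → Prop} {p : V → Γ}
    (h : ∀ e, c e → label G p (e, true) = 1) (s : E × Bool) (hs : c s.1) : label G p s = 1 := by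
  rcases s with ⟨e, _ | _⟩
  · have := label_stepRev (G := G) p (e, true)
    rwa [h e hs, inv_one] at this
  · exact h e hs

theorem NearPotential.exists_glue {X Y Z : Subgraph G} {u : V} {δ : Γ} {p q : V → Γ}
    (hX : NearPotential X u δ p) (hY : NearPotential Y u δ q)
    (hpq : ∀ x ∈ X.verts ∩ Y.verts, p x = q x)
    (hZ : ∀ e ∈ Z.edges, e ∈ X.edges ∨ e ∈ Y.edges) : ∃ m, NearPotential Z u δ m := by
  refine ⟨fun x => if x ∈ X.verts then p x else q x, (hX.congr ?_).of_union (hY.congr ?_) hZ⟩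
  · intro x hx
    rw [if_pos hx]
  · intro x hx
    split_ifs with h
    · exact hpq x (Finset.mem_inter.2 ⟨h, hx⟩)
    · rfl

end Ratio

section Gluing

set_option linter.unusedSectionVars false

variable {V E : Type} [DecidableEq V] {k j : ℕ} [NeZero k]
  {G : GainedGraph V E (Multiplicative (ZMod k))} {G₀ I X Y Z : Subgraph G}

/-- `Z` is glued from the connected subgraphs `X` and `Y` along the sparse subgraph `I`. -/
structure Gluing (G₀ I X Y Z : Subgraph G) : Prop where
  le_base : I ≤ G₀
  le_left : I ≤ X
  le_right : I ≤ Y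
  inter_subset : X.verts ∩ Y.verts ⊆ I.verts
  edges_mem : ∀ e ∈ Z.edges, e ∈ X.edges ∨ e ∈ Y.edges
  verts_mem : ∀ x ∈ Z.verts, x ∈ X.verts ∨ x ∈ Y.verts
  left_conn : Connected G X
  right_conn : Connected G Y
  left_fixed : X.fixedVerts.card ≤ 1
  right_fixed : Y.fixedVerts.card ≤ 1
  glued_fixed : Z.fixedVerts.card ≤ 1
  nonempty : I.edges.Nonempty

theorem Gluing.symm (h : Gluing G₀ I X Y Z) : Gluing G₀ I Y X Z where
  le_base := h.le_base
  le_left := h.le_right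
  le_right := h.le_left
  inter_subset := by rw [Finset.inter_comm]; exact h.inter_subset
  edges_mem e he := (h.edges_mem e he).symm
  verts_mem x hx := (h.verts_mem x hx).symm
  left_conn := h.right_conn
  right_conn := h.left_conn
  left_fixed := h.right_fixed
  right_fixed := h.left_fixed
  glued_fixed := h.glued_fixed
  nonempty := h.nonempty

theorem Gluing.noFixed (h : Gluing G₀ I X Y Z) (hX : NoFixed G X) (hY : NoFixed G Y) :
    NoFixed G Z :=
  fun x hx => (h.verts_mem x hx).elim (hX x) (hY x)

theorem NoFixed.freeVerts_eq (hX : NoFixed G X) : X.freeVerts = X.verts :=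
  Finset.sdiff_eq_self_of_disjoint (Finset.disjoint_left.2 hX)

/-- Gluing near-balancing potentials that agree on the intersection. -/
theorem Gluing.redAlpha_le_two (hj : 2 ≤ j) (h : Gluing G₀ I X Y Z) (hX : NoFixed G X)
    (hY : NoFixed G Y) {u : V} {δ : Multiplicative (ZMod k)}
    {p q : V → Multiplicative (ZMod k)} (hp : NearPotential X u δ p)
    (hq : NearPotential Y u δ q) (hpq : ∀ x ∈ I.verts, p x = q x) : redAlpha k j Z ≤ 2 := by
  obtain ⟨m, hm⟩ := hp.exists_glue hq (fun x hx => hpq x (h.inter_subset hx)) h.edges_mem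
  exact hm.redAlpha_le hj (h.noFixed hX hY)

theorem CountSparse.card_edges_le_of_potential (hj : 2 ≤ j) (hG₀ : CountSparse k j G₀)
    {F : Subgraph G} (hF : F ≤ G₀) (hfix : NoFixed G F) {p : V → Multiplicative (ZMod k)}
    (hp : ∀ e ∈ F.edges, label G p (e, true) = 1) (hV : 2 ≤ F.verts.card) :
    (F.edges.card : ℤ) ≤ 2 * (F.verts.card : ℤ) - 3 := by
  by_cases hE : F.edges.Nonempty
  · have := hG₀.card_edges_le_of_balanced hj hF hE (powBalanced_one_iff.2 ⟨p, fun s hs =>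
      label_forall_of_true (c := (· ∈ F.edges)) hp s ((freePart_le F).2 hs)⟩) hfix
    rwa [hfix.freeVerts_eq] at this
  · rw [Finset.not_nonempty_iff_eq_empty] at hE
    rw [hE, Finset.card_empty]
    omega

/-- The subgraph of `I` with vertex set `W` and those edges inside `W` satisfying `c`. -/
noncomputable def restrictTo (I : Subgraph G) (W : Finset V) (c : E → Prop) : Subgraph G where
  verts := W
  edges := I.edges.filter fun e => c e ∧ G.tail e ∈ W ∧ G.head e ∈ W
  tail_mem _ he := (Finset.mem_filter.1 he).2.2.1
  head_mem _ he := (Finset.mem_filter.1 he).2.2.2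

theorem mem_restrictTo_edges {W : Finset V} {c : E → Prop} {e : E} :
    e ∈ (restrictTo I W c).edges ↔ e ∈ I.edges ∧ c e ∧ G.tail e ∈ W ∧ G.head e ∈ W :=
  Finset.mem_filter

theorem restrictTo_le {W : Finset V} {c : E → Prop} (hW : W ⊆ I.verts) :
    restrictTo I W c ≤ I :=
  ⟨hW, Finset.filter_subset _ _⟩

/-- An edge partition into two subgraphs on the vertex sets `W₁` and `W₂`. -/
theorem card_edges_le_add {W₁ W₂ : Finset V} {c₁ c₂ : E → Prop}
    (h : ∀ e ∈ I.edges, (c₁ e ∧ G.tail e ∈ W₁ ∧ G.head e ∈ W₁) ∨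
      (c₂ e ∧ G.tail e ∈ W₂ ∧ G.head e ∈ W₂)) :
    I.edges.card ≤ (restrictTo I W₁ c₁).edges.card + (restrictTo I W₂ c₂).edges.card := by
  refine (Finset.card_le_card fun e he => ?_).trans (Finset.card_union_le _ _)
  rw [Finset.mem_union]
  rcases h e he with h | h
  · exact Or.inl (mem_restrictTo_edges.2 ⟨he, h⟩)
  · exact Or.inr (mem_restrictTo_edges.2 ⟨he, h⟩)

theorem CountSparse.card_edges_le_of_two_potentials (hj : 2 ≤ j) (hG₀ : CountSparse k j G₀)
    (hI : I ≤ G₀) (hfix : NoFixed G I) {p₁ p₂ : V → Multiplicative (ZMod k)} {W₁ W₂ : Finset V}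
    (hW₁ : W₁ ⊆ I.verts) (hW₂ : W₂ ⊆ I.verts) (h₁ : 2 ≤ W₁.card) (h₂ : 2 ≤ W₂.card)
    (h : ∀ e ∈ I.edges, (label G p₁ (e, true) = 1 ∧ G.tail e ∈ W₁ ∧ G.head e ∈ W₁) ∨
      (label G p₂ (e, true) = 1 ∧ G.tail e ∈ W₂ ∧ G.head e ∈ W₂)) :
    (I.edges.card : ℤ) ≤ 2 * (W₁.card : ℤ) + 2 * (W₂.card : ℤ) - 6 := by
  have key : ∀ (p : V → Multiplicative (ZMod k)) (W : Finset V), W ⊆ I.verts → 2 ≤ W.card →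
      ((restrictTo I W fun e => label G p (e, true) = 1).edges.card : ℤ) ≤
        2 * (W.card : ℤ) - 3 := by
    intro p W hW hc
    have hle := restrictTo_le (c := fun e => label G p (e, true) = 1) hW
    exact hG₀.card_edges_le_of_potential hj ⟨hle.1.trans hI.1, hle.2.trans hI.2⟩
      (hfix.mono hle) (fun e he => (mem_restrictTo_edges.1 he).2.1) hc
  have h1 := key p₁ W₁ hW₁ h₁
  have h2 := key p₂ W₂ hW₂ h₂
  have h3 := card_edges_le_add h
  omega

end Gluing

section GluingCases

set_option linter.unusedSectionVars false

variable {V E : Type} [DecidableEq V] {k j : ℕ} [NeZero k]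
  {G : GainedGraph V E (Multiplicative (ZMod k))} {G₀ I X Y Z : Subgraph G}

/-- A symmetric property of steps that splits `I` into two parts yields a splitting of the
edges of `I`. -/
theorem split_edges_of_steps {c₁ c₂ : E × Bool → Prop} (h₁ : ∀ s, c₁ (stepRev s) → c₁ s)
    (h₂ : ∀ s, c₂ (stepRev s) → c₂ s) {W₁ W₂ : Finset V} {u : V}
    (hstart : ∀ s : E × Bool, s.1 ∈ I.edges → stepStart G s = u →
      (c₁ s ∧ stepStart G s ∈ W₁ ∧ stepEnd G s ∈ W₁) ∨
        (c₂ s ∧ stepStart G s ∈ W₂ ∧ stepEnd G s ∈ W₂))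
    (hne : ∀ s : E × Bool, s.1 ∈ I.edges → stepStart G s ≠ u → stepEnd G s ≠ u →
      (c₁ s ∧ stepStart G s ∈ W₁ ∧ stepEnd G s ∈ W₁) ∨
        (c₂ s ∧ stepStart G s ∈ W₂ ∧ stepEnd G s ∈ W₂)) :
    ∀ e ∈ I.edges, (c₁ (e, true) ∧ G.tail e ∈ W₁ ∧ G.head e ∈ W₁) ∨
      (c₂ (e, true) ∧ G.tail e ∈ W₂ ∧ G.head e ∈ W₂) := by
  intro e he
  by_cases ht : G.tail e = u
  · exact hstart (e, true) he ht
  · by_cases hh : G.head e = u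
    · refine (hstart (stepRev (e, true)) he ((stepStart_stepRev _).trans hh)).imp ?_ ?_
      · rintro ⟨a, b, c⟩
        rw [stepStart_stepRev] at b
        rw [stepEnd_stepRev] at c
        exact ⟨h₁ _ a, c, b⟩
      · rintro ⟨a, b, c⟩
        rw [stepStart_stepRev] at b
        rw [stepEnd_stepRev] at c
        exact ⟨h₂ _ a, c, b⟩
    · exact hne (e, true) he ht hh

theorem label_eq_one_of_stepRev {Γ : Type} [CommGroup Γ] {G : GainedGraph V E Γ} {p : V → Γ}
    (s : E × Bool) (h : label G p (stepRev s) = 1) : label G p s = 1 := by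
  rwa [label_stepRev, inv_eq_one] at h

theorem card_filter_add_card_insert {W : Finset V} {u : V} (c : V → Prop) (hc : c u)
    : (W.filter c).card + (insert u (W.filter fun x => ¬ c x)).card = W.card + 1 := by
  rw [Finset.card_insert_of_notMem (by simp [hc]), ← add_assoc,
    Finset.card_filter_add_card_filter_not]

theorem mul_inv_ratio {Γ : Type} [CommGroup Γ] (p q : V → Γ) (x : V) :
    q x * (ratio p q x)⁻¹ = p x := by
  simp [ratio]

/-- Gluing a near-balanced and a balanced subgraph. -/
theorem Gluing.balanced_right (hj : 2 ≤ j) (hG₀ : CountSparse k j G₀)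
    (h : Gluing G₀ I X Y Z) (hX : NoFixed G X) (hY : NoFixed G Y) {w u : V}
    {δ : Multiplicative (ZMod k)} {p q : V → Multiplicative (ZMod k)}
    (hp : NearPotential X u δ p) (hq : ∀ s : E × Bool, s.1 ∈ Y.edges → label G q s = 1)
    (hconn : ∀ x ∈ I.verts, Reachable G I w x) :
    redAlpha k j Z ≤ 2 ∨ (I.edges.card : ℤ) ≤ 2 * (I.verts.card : ℤ) - 4 := by
  have hstep : ∀ s : E × Bool, s.1 ∈ I.edges →
      ratio p q (stepEnd G s) = ratio p q (stepStart G s) * label G p s :=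
    fun s hs => ratio_eq_of_label_right (hq s (h.le_right.2 hs))
  have hglue : ∀ a, (∀ x ∈ I.verts, ratio p q x = a) → redAlpha k j Z ≤ 2 := by
    intro a ha
    refine h.redAlpha_le_two hj hX hY hp
      ((nearPotential_of_label_one (u := u) (δ := δ) hq).const_mul a⁻¹) fun x hx => ?_
    rw [← ha x hx, mul_inv_ratio]
  by_cases hu : u ∈ I.verts
  swap
  · left
    refine hglue (ratio p q w) fun x hx => ratio_eq_of_reachable (F := I) (fun s hs => ?_)
      (hconn x hx)
    rw [hq s (h.le_right.2 hs), (hp s (h.le_left.2 hs)).1 (fun h' => hu (h' ▸ stepStart_mem hs))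
      (fun h' => hu (h' ▸ stepEnd_mem hs))]
  have hr : ∀ x ∈ I.verts, ratio p q x = ratio p q u ∨ ratio p q x = ratio p q u * δ := by
    intro x hx
    refine ((hconn u hu).symm.trans (hconn x hx)).induct
      (P := fun x => ratio p q x = ratio p q u ∨ ratio p q x = ratio p q u * δ) ?_ (Or.inl rfl)
    intro s hs hs'
    rw [hstep s hs]
    obtain ⟨h1, h2, -⟩ := hp s (h.le_left.2 hs)
    by_cases he : stepEnd G s = u
    · left
      rw [← hstep s hs, he]
    · by_cases hst : stepStart G s = u
      · rcases h2 hst he with h' | h' <;> simp [h', hst]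
      · simpa [h1 hst he] using hs'
  by_cases hV₂ : ∀ x ∈ I.verts, ratio p q x = ratio p q u
  · exact Or.inl (hglue _ hV₂)
  by_cases hV₁ : ∀ x ∈ I.verts, x ≠ u → ratio p q x ≠ ratio p q u
  · left
    refine h.redAlpha_le_two hj hX hY hp ((nearPotential_of_shift (u := u) (δ := δ) hq
      (fun _ _ => rfl)).const_mul (ratio p q u * δ)⁻¹) fun x hx => ?_
    by_cases hxu : x = u
    · subst hxu
      rw [if_pos rfl, mul_inv, mul_comm (ratio p q x)⁻¹, ← mul_assoc, mul_inv_cancel_right,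
        mul_inv_ratio]
    · rw [if_neg hxu, mul_one, ← (hr x hx).resolve_left (hV₁ x hx hxu), mul_inv_ratio]
  right
  push Not at hV₁ hV₂
  obtain ⟨x₂, hx₂, hx₂r⟩ := hV₂
  obtain ⟨x₁, hx₁, hx₁u, hx₁r⟩ := hV₁
  have hcard : (I.verts.filter fun x => ratio p q x = ratio p q u).card +
      (insert u (I.verts.filter fun x => ¬ ratio p q x = ratio p q u)).card =
        I.verts.card + 1 := by
    convert card_filter_add_card_insert (fun x => ratio p q x = ratio p q u) rfl
  have hx₂u : u ≠ x₂ := by rintro rfl; exact hx₂r rfl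
  have := hG₀.card_edges_le_of_two_potentials hj h.le_base (hX.mono h.le_left) (p₁ := q)
    (p₂ := q) (W₁ := I.verts.filter fun x => ratio p q x = ratio p q u)
    (W₂ := insert u (I.verts.filter fun x => ¬ ratio p q x = ratio p q u))
    (Finset.filter_subset _ _)
    (Finset.insert_subset hu (Finset.filter_subset _ _))
    (Finset.one_lt_card.2 ⟨u, by simp [hu], x₁, by simp [hx₁, hx₁r], hx₁u.symm⟩)
    (Finset.one_lt_card.2 ⟨u, by simp, x₂, by simp [hx₂, hx₂r], hx₂u⟩)
    (split_edges_of_steps (c₁ := fun s => label G q s = 1) (c₂ := fun s => label G q s = 1)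
      (u := u) label_eq_one_of_stepRev label_eq_one_of_stepRev ?_ ?_)
  · omega
  · intro s hs hsu
    have h1 := hq s (h.le_right.2 hs)
    have h2 := stepEnd_mem hs
    by_cases h3 : ratio p q (stepEnd G s) = ratio p q u
    · left; simp [h1, h2, h3, hsu, hu]
    · right; simp [h1, h2, h3, hsu, hu]
  · intro s hs hsu heu
    have h1 := hq s (h.le_right.2 hs)
    have h2 := stepEnd_mem hs
    have h2' := stepStart_mem hs
    have h4 := hstep s hs
    rw [(hp s (h.le_left.2 hs)).1 hsu heu, mul_one] at h4
    by_cases h3 : ratio p q (stepStart G s) = ratio p q u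
    · left; simp [h1, h2, h2', h4, h3]
    · right; simp [h1, h2, h2', h4, h3]

/-- Two near-balanced subgraphs with distinct base vertices. -/
theorem Gluing.card_edges_le_of_base_ne (hj : 2 ≤ j) (hG₀ : CountSparse k j G₀)
    (h : Gluing G₀ I X Y Z) (hX : NoFixed G X) {u u' : V} (hu : u ∈ I.verts)
    (hu' : u' ∈ I.verts) (huu : u ≠ u')
    {δ δ' : Multiplicative (ZMod k)} {p q : V → Multiplicative (ZMod k)}
    (hδ : δ ≠ 1) (hp : NearPotential X u δ p) (hq : NearPotential Y u' δ' q) :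
    (I.edges.card : ℤ) ≤ 2 * (I.verts.card : ℤ) - 2 := by
  set C := (I.verts.erase u).erase u' with hC
  have hCcard : C.card + 2 = I.verts.card := by
    rw [hC, Finset.card_erase_of_mem (Finset.mem_erase.2 ⟨huu.symm, hu'⟩),
      Finset.card_erase_of_mem hu]
    have : 1 < I.verts.card := Finset.one_lt_card.2 ⟨u, hu, u', hu', huu⟩
    omega
  have hCsub : C ⊆ I.verts := (Finset.erase_subset _ _).trans (Finset.erase_subset _ _)
  have hins : ∀ (c : V → Prop) [DecidablePred c], (insert u (insert u' (C.filter c))).card = (C.filter c).card + 2 ∧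
      insert u (insert u' (C.filter c)) ⊆ I.verts := by
    intro c _
    constructor
    · rw [Finset.card_insert_of_notMem (by simp [hC, huu]),
        Finset.card_insert_of_notMem (by simp [hC])]
    · exact Finset.insert_subset hu (Finset.insert_subset hu'
        ((Finset.filter_subset _ _).trans hCsub))
  have hc1 := hins fun x => ratio p q x = ratio p q u
  have hc2 := hins fun x => ¬ ratio p q x = ratio p q u
  have hc3 : (C.filter fun x => ratio p q x = ratio p q u).card +
      (C.filter fun x => ¬ ratio p q x = ratio p q u).card = C.card := by
    convert Finset.card_filter_add_card_filter_not (s := C) fun x => ratio p q x = ratio p q u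
  have := hG₀.card_edges_le_of_two_potentials hj h.le_base (hX.mono h.le_left) (p₁ := p)
    (p₂ := fun x => p x * if x = u then δ⁻¹ else 1)
    hc1.2 hc2.2 (by omega) (by omega)
    (split_edges_of_steps (c₁ := fun s => label G p s = 1)
      (c₂ := fun s => label G (fun x => p x * if x = u then δ⁻¹ else 1) s = 1)
      (u := u) label_eq_one_of_stepRev label_eq_one_of_stepRev ?_ ?_)
  · omega
  · intro s hs hsu
    have hsp := hp s (h.le_left.2 hs)
    have hsq := hq s (h.le_right.2 hs)
    rw [label_mul p (fun x => if x = u then δ⁻¹ else 1)]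
    have hstart : stepStart G s ≠ u' := by rwa [hsu]
    by_cases heu : stepEnd G s = u
    · left
      have := hsq.1 hstart (by rwa [heu])
      rw [label_eq_gain (hsu.trans heu.symm)] at this ⊢
      simp [this, hsu, heu]
    · by_cases heu' : stepEnd G s = u'
      · rcases hsp.2.1 hsu heu with h' | h'
        · left; simp [h', hsu, heu']
        · right; simp [h', hsu, heu', huu.symm]
      · have hr := ratio_eq_of_label_right (p := p) (hsq.1 hstart heu')
        rw [hsu] at hr
        have hmem := stepEnd_mem hs
        rcases hsp.2.1 hsu heu with h' | h'
        · left
          rw [h', mul_one] at hr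
          simp [h', hsu, heu, heu', hr, hC, hmem]
        · right
          rw [h'] at hr
          simp [h', hsu, heu, heu', hr, hC, hmem, hδ]
  · intro s hs hsu heu
    have hsp := (hp s (h.le_left.2 hs)).1 hsu heu
    have hsq := hq s (h.le_right.2 hs)
    rw [label_mul p (fun x => if x = u then δ⁻¹ else 1)]
    have hmem := stepEnd_mem hs
    have hmem' := stepStart_mem hs
    by_cases hsu' : stepStart G s = u'
    · by_cases heu' : stepEnd G s = u'
      · left; simp [hsp, hsu', heu']
      · by_cases hr : ratio p q (stepEnd G s) = ratio p q u
        · left; simp [hsp, hsu', heu', heu, hr, hC, hmem]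
        · right; simp [hsp, hsu', heu', heu, hr, hC, hmem, huu.symm]
    · by_cases heu' : stepEnd G s = u'
      · by_cases hr : ratio p q (stepStart G s) = ratio p q u
        · left; simp [hsp, hsu', heu', hsu, hr, hC, hmem']
        · right; simp [hsp, hsu', heu', hsu, hr, hC, hmem', huu.symm]
      · have hrr := ratio_eq_of_label_right (p := p) (hsq.1 hsu' heu')
        rw [hsp, mul_one] at hrr
        by_cases hr : ratio p q (stepStart G s) = ratio p q u
        · left; simp [hsp, hsu', heu', hsu, heu, hr, hrr, hC, hmem, hmem']
        · right; simp [hsp, hsu', heu', hsu, heu, hr, hrr, hC, hmem, hmem']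

end GluingCases

section GluingSameBase

set_option linter.unusedSectionVars false

variable {V E : Type} [DecidableEq V] {k j : ℕ} [NeZero k]
  {G : GainedGraph V E (Multiplicative (ZMod k))} {G₀ I X Y Z : Subgraph G}

theorem CountSparse.card_edges_le_of_nearPotential (hj : 2 ≤ j) (hG₀ : CountSparse k j G₀)
    {F : Subgraph G} (hF : F ≤ G₀) (hfix : NoFixed G F) {u : V} {δ : Multiplicative (ZMod k)}
    {p : V → Multiplicative (ZMod k)} (hp : NearPotential F u δ p) (hV : F.verts.Nonempty) :
    (F.edges.card : ℤ) ≤ 2 * (F.verts.card : ℤ) - 1 := by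
  by_cases hE : F.edges.Nonempty
  · have := hG₀.card_edges_le_of_forall hj hF hE (c := 2) fun P hP =>
      (hp.mono hP).redAlpha_le hj (hfix.mono hP)
    rw [hfix.freeVerts_eq] at this
    linarith
  · rw [Finset.not_nonempty_iff_eq_empty] at hE
    have := hV.card_pos
    rw [hE, Finset.card_empty]
    omega

/-- Two near-balanced subgraphs with the same base vertex and the same gain. -/
theorem Gluing.same_gain (hj : 2 ≤ j) (hG₀ : CountSparse k j G₀)
    (h : Gluing G₀ I X Y Z) (hX : NoFixed G X) (hY : NoFixed G Y) {u : V} (hu : u ∈ I.verts)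
    {δ : Multiplicative (ZMod k)} {p q : V → Multiplicative (ZMod k)} (hδ : δ ^ 2 ≠ 1)
    (hp : NearPotential X u δ p) (hq : NearPotential Y u δ q) :
    redAlpha k j Z ≤ 2 ∨ (I.edges.card : ℤ) ≤ 2 * (I.verts.card : ℤ) - 2 := by
  by_cases hV₂ : ∀ x ∈ I.verts, ratio p q x = ratio p q u
  · refine Or.inl (h.redAlpha_le_two hj hX hY hp (hq.const_mul (ratio p q u)⁻¹) fun x hx => ?_)
    rw [← hV₂ x hx, mul_inv_ratio]
  right
  push Not at hV₂
  obtain ⟨x₂, hx₂, hx₂r⟩ := hV₂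
  have hx₂u : u ≠ x₂ := by rintro rfl; exact hx₂r rfl
  let m : V → Multiplicative (ZMod k) :=
    fun x => if x ≠ u ∧ ratio p q x = ratio p q u * δ then δ else 1
  have hmu : m u = 1 := if_neg fun h' => h'.1 rfl
  have hcard : (I.verts.filter fun x => ratio p q x = ratio p q u).card +
      (insert u (I.verts.filter fun x => ¬ ratio p q x = ratio p q u)).card =
        I.verts.card + 1 := by
    convert card_filter_add_card_insert (fun x => ratio p q x = ratio p q u) rfl
  set W₁ := I.verts.filter fun x => ratio p q x = ratio p q u with hW₁
  set W₂ := insert u (I.verts.filter fun x => ¬ ratio p q x = ratio p q u) with hW₂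
  have hW₁I : W₁ ⊆ I.verts := Finset.filter_subset _ _
  have hW₂I : W₂ ⊆ I.verts := Finset.insert_subset hu (Finset.filter_subset _ _)
  have hsplit := split_edges_of_steps (I := I) (W₁ := W₁) (W₂ := W₂) (u := u)
    (c₁ := fun _ => True) (c₂ := fun s => label G (fun x => p x * m x) s = 1) (fun _ h => h)
    label_eq_one_of_stepRev ?_ ?_
  · have h0 := card_edges_le_add hsplit
    have hle₁ := restrictTo_le (c := fun _ => True) hW₁I
    have hle₂ := restrictTo_le (c := fun e => label G (fun x => p x * m x) (e, true) = 1) hW₂I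
    have h1 := hG₀.card_edges_le_of_nearPotential hj
      ⟨hle₁.1.trans h.le_base.1, hle₁.2.trans h.le_base.2⟩ (hX.mono
        ⟨hle₁.1.trans h.le_left.1, hle₁.2.trans h.le_left.2⟩)
      ((hp.mono h.le_left).mono hle₁) ⟨u, by simp [restrictTo, hW₁, hu]⟩
    have h2 := hG₀.card_edges_le_of_potential hj
      ⟨hle₂.1.trans h.le_base.1, hle₂.2.trans h.le_base.2⟩ (hX.mono
        ⟨hle₂.1.trans h.le_left.1, hle₂.2.trans h.le_left.2⟩)
      (fun e he => (mem_restrictTo_edges.1 he).2.1)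
      (Finset.one_lt_card.2 ⟨u, by simp [restrictTo, hW₂], x₂,
        by simp [restrictTo, hW₂, hx₂, hx₂r], hx₂u⟩)
    have h3 : (restrictTo I W₁ fun _ => True).verts.card = W₁.card := rfl
    have h4 : (restrictTo I W₂ fun e =>
      label G (fun x => p x * m x) (e, true) = 1).verts.card = W₂.card := rfl
    omega
  · intro s hs hsu
    have hmem := stepEnd_mem hs
    by_cases hr : ratio p q (stepEnd G s) = ratio p q u
    · exact Or.inl ⟨trivial, by simp [hW₁, hsu, hu], by simp [hW₁, hmem, hr]⟩
    · have heu : stepEnd G s ≠ u := fun h' => hr (by rw [h'])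
      refine Or.inr ⟨?_, by simp [hW₂, hsu], by simp [hW₂, hmem, hr]⟩
      have hrat := label_eq_ratio (G := G) p q s
      rw [hsu] at hrat
      rw [label_mul, hsu, hmu, one_mul]
      rcases (hp s (h.le_left.2 hs)).2.1 hsu heu with h1 | h1 <;>
        rcases (hq s (h.le_right.2 hs)).2.1 hsu heu with h2 | h2 <;> rw [h1, h2] at hrat
      · exact absurd (mul_inv_eq_one.1 (by simpa using hrat.symm)).symm hr
      · have hne : ratio p q (stepEnd G s) ≠ ratio p q u * δ := by
          intro h'
          apply hδ
          rw [h', mul_one, mul_inv, mul_inv_cancel_left] at hrat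
          rw [sq]
          nth_rw 1 [hrat]
          exact inv_mul_cancel δ
        simp [m, hne, h1]
      · have heq : ratio p q (stepEnd G s) = ratio p q u * δ := by
          rw [mul_right_comm, eq_comm, mul_inv_eq_one] at hrat
          exact hrat.symm
        simp [m, heq, heu, h1]
      · exact absurd (mul_inv_eq_one.1 (mul_eq_right.1 hrat.symm)).symm hr
  · intro s hs hsu heu
    have hmem := stepEnd_mem hs
    have hmem' := stepStart_mem hs
    have h1 := (hp s (h.le_left.2 hs)).1 hsu heu
    have h2 := ratio_eq_of_label_eq (((hq s (h.le_right.2 hs)).1 hsu heu).trans h1.symm)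
    by_cases hr : ratio p q (stepStart G s) = ratio p q u
    · exact Or.inl ⟨trivial, by simp [hW₁, hmem', hr], by simp [hW₁, hmem, h2, hr]⟩
    · refine Or.inr ⟨?_, by simp [hW₂, hmem', hr], by simp [hW₂, hmem, h2, hr]⟩
      rw [label_mul, h1]
      simp [m, h2, hsu, heu]

/-- Two near-balanced subgraphs with the same base vertex and essentially different gains meet
in a balanced subgraph. -/
theorem NearPotential.powBalanced_of_gain_ne {u : V} {δ δ' : Multiplicative (ZMod k)}
    {p q : V → Multiplicative (ZMod k)} (hδ : δ ≠ 1) (hne : δ' ≠ δ) (hne' : δ' ≠ δ⁻¹)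
    (hp : NearPotential I u δ p) (hq : NearPotential I u δ' q) : PowBalanced 1 I := by
  let m : V → Multiplicative (ZMod k) := fun x =>
    if x ≠ u ∧ (ratio p q x = ratio p q u * δ ∨ ratio p q x = ratio p q u * (δ * δ'⁻¹))
      then δ else 1
  have hmu : m u = 1 := if_neg fun h' => h'.1 rfl
  have hstart : ∀ s : E × Bool, s.1 ∈ I.edges → stepStart G s = u →
      label G (fun x => p x * m x) s = 1 := by
    intro s hs hsu
    rw [label_mul, hsu, hmu, one_mul]
    by_cases heu : stepEnd G s = u
    · rw [heu, hmu, inv_one, one_mul]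
      have hg : label G p s = label G q s := by
        rw [label_eq_gain (hsu.trans heu.symm), label_eq_gain (hsu.trans heu.symm)]
      rcases hp.label_mem hs with h1 | h1 | h1
      · exact h1
      · rcases hq.label_mem hs with h2 | h2 | h2
        · rw [hg, h2]
        · exact absurd (h2.symm.trans (hg.symm.trans h1)) hne
        · refine absurd ?_ hne'
          rw [← h1, hg, h2, inv_inv]
      · rcases hq.label_mem hs with h2 | h2 | h2
        · rw [hg, h2]
        · exact absurd (h2.symm.trans (hg.symm.trans h1)) hne'
        · exact absurd (inv_injective (h2.symm.trans (hg.symm.trans h1))) hne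
    · have hrat : ratio p q (stepEnd G s) = ratio p q u * (label G p s * (label G q s)⁻¹) := by
        rw [label_eq_ratio p q s, hsu, mul_inv, mul_inv, inv_inv, mul_assoc (ratio p q u)⁻¹,
          mul_left_comm (label G p s), mul_left_comm (label G p s), mul_inv_cancel, mul_one,
          mul_inv_cancel_left]
      rcases (hp s hs).2.1 hsu heu with h1 | h1 <;>
        rcases (hq s hs).2.1 hsu heu with h2 | h2 <;> rw [h1, h2] at hrat
      · have : ¬ (δ * δ'⁻¹ = 1) := fun h' => hne (mul_inv_eq_one.1 h').symm
        simp [m, hrat, h1, this, hδ]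
      · have : ¬ (δ'⁻¹ = δ) := fun h' => hne' (by rw [← h', inv_inv])
        simp [m, hrat, h1, this, hδ]
      · simp [m, hrat, h1, heu]
      · simp [m, hrat, h1, heu]
  refine powBalanced_one_iff.2 ⟨fun x => p x * m x, fun s hs => ?_⟩
  have hs' := (freePart_le I).2 hs
  by_cases hsu : stepStart G s = u
  · exact hstart s hs' hsu
  by_cases heu : stepEnd G s = u
  · exact label_eq_one_of_stepRev s (hstart (stepRev s) hs' ((stepStart_stepRev _).trans heu))
  have h1 := (hp s hs').1 hsu heu
  have h2 := ratio_eq_of_label_eq (((hq s hs').1 hsu heu).trans h1.symm)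
  rw [label_mul, h1]
  simp [m, h2, hsu, heu]

end GluingSameBase

section GluingCount

set_option linter.unusedSectionVars false

variable {V E : Type} [DecidableEq V] {k j : ℕ} [NeZero k]
  {G : GainedGraph V E (Multiplicative (ZMod k))} {G₀ I X Y Z : Subgraph G}

theorem NoFixed.exists_label_eq_one {Γ : Type} [CommGroup Γ] {G : GainedGraph V E Γ}
    {X : Subgraph G} (hX : NoFixed G X) (hb : PowBalanced 1 X) :
    ∃ p : V → Γ, ∀ s : E × Bool, s.1 ∈ X.edges → label G p s = 1 := by
  obtain ⟨p, hp⟩ := powBalanced_one_iff.1 hb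
  exact ⟨p, fun s hs => hp s (hX.mem_freePart.2 hs)⟩

/-- The submodular inequality when one of the two subgraphs is near-balanced and the
intersection is connected. -/
theorem Gluing.count_of_nearBalanced (hj : 2 ≤ j) (hG₀ : CountSparse k j G₀)
    (h : Gluing G₀ I X Y Z) (hfull : FullType j X) (hnb : NearBalanced G X)
    (hI : Connected G I) :
    (I.edges.card : ℤ) + redAlpha k j Z ≤
      redAlpha k j X + redAlpha k j Y - 3 + 2 * (I.freeVerts.card : ℤ) := by
  have hX := hnb.1
  have hIfix := hX.mono h.le_left
  obtain ⟨u, -, δ, p, hδ, hp⟩ := hfull.exists_nearPotential hj h.left_conn hnb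
  have hpI := hp.mono h.le_left
  have hcount := hG₀.count I h.le_base h.nonempty hI
  have haI := hpI.redAlpha_le (k := k) hj hIfix
  have haX := redAlpha_of_nearBalanced (k := k) hj hfull hnb
  have haZ := redAlpha_le_three (k := k) hj h.glued_fixed
  have haY := redAlpha_nonneg (k := k) hj h.right_fixed
  have hV := hIfix.freeVerts_eq
  rw [hV] at hcount ⊢
  by_cases hbal : PowBalanced 1 I
  · have haI' := (redAlpha_eq_zero_iff hj (hG₀.fixed_card_of_le hj h.le_base)).2 ⟨hbal, hIfix⟩
    by_cases hY0 : redAlpha k j Y = 0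
    · obtain ⟨hYb, hY⟩ := (redAlpha_eq_zero_iff hj h.right_fixed).1 hY0
      obtain ⟨q, hq⟩ := hY.exists_label_eq_one hYb
      obtain ⟨w, hw⟩ := hI.1
      rcases h.balanced_right hj hG₀ hX hY hp hq (hI.2 w hw) with h' | h' <;> omega
    · omega
  · have hfullI := hp.fullType hfull h.le_left hbal
    have hfullY := hfullI.mono h.le_right
    by_cases hYnb : NearBalanced G Y
    · have haY' := redAlpha_of_nearBalanced (k := k) hj hfullY hYnb
      obtain ⟨u', -, δ', q, hδ', hq⟩ := hfullY.exists_nearPotential hj h.right_conn hYnb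
      have hu : u ∈ I.verts := by
        by_contra hu
        exact hbal (hp.powBalanced_of_notMem h.le_left hu)
      have hu' : u' ∈ I.verts := by
        by_contra hu
        exact hbal (hq.powBalanced_of_notMem h.le_right hu)
      have hδ1 : δ ≠ 1 := by rintro rfl; simp at hδ
      by_cases huu : u = u'
      · subst huu
        have key : redAlpha k j Z ≤ 2 ∨
            (I.edges.card : ℤ) ≤ 2 * (I.verts.card : ℤ) - 2 := by
          by_cases h1 : δ' = δ
          · subst h1
            exact h.same_gain hj hG₀ hX hYnb.1 hu hδ hp hq
          by_cases h2 : δ' = δ⁻¹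
          · have hq' := hq.inv
            rw [h2, inv_inv] at hq'
            exact h.same_gain hj hG₀ hX hYnb.1 hu hδ hp hq'
          exact absurd (hpI.powBalanced_of_gain_ne hδ1 h1 h2 (hq.mono h.le_right)) hbal
        omega
      · have := h.card_edges_le_of_base_ne hj hG₀ hX hu hu' huu hδ1 hp hq
        omega
    · have haY' := redAlpha_of_not (k := k) hj h.right_fixed fun h' => hYnb h'.2
      rw [hfullY.alphaSum_eq] at haY'
      omega

theorem alphaSum_add_le {w : V} (h : Gluing G₀ I X Y Z)
    (hconn : ∀ x ∈ I.freeVerts, Reachable G (freePart I) w x) :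
    alphaSum j I + alphaSum j Z ≤ alphaSum j X + alphaSum j Y := by
  have key : ∀ c, PowBalanced c X → PowBalanced c Y → PowBalanced c Z := fun c hX hY =>
    hX.glue hY h.le_left h.le_right h.inter_subset h.edges_mem hconn
  have hl : ∀ c, PowBalanced c X → PowBalanced c I := fun c => PowBalanced.mono h.le_left
  have hr : ∀ c, PowBalanced c Y → PowBalanced c I := fun c => PowBalanced.mono h.le_right
  have hfl : NoFixed G X → NoFixed G I := NoFixed.mono h.le_left
  have hfr : NoFixed G Y → NoFixed G I := NoFixed.mono h.le_right
  have main : ∀ (i x y z : Prop) [Decidable i] [Decidable x] [Decidable y] [Decidable z],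
      (x → i) → (y → i) → (x → y → z) →
      (if i then (0 : ℤ) else 1) + (if z then 0 else 1) ≤
        (if x then 0 else 1) + if y then 0 else 1 := by
    intro i x y z _ _ _ _ h1 h2 h3
    by_cases hx : x <;> by_cases hy : y <;> by_cases hi : i <;> by_cases hz : z <;>
      simp_all
  have e1 := main (PowBalanced (j - 1) I ∧ NoFixed G I) (PowBalanced (j - 1) X ∧ NoFixed G X)
    (PowBalanced (j - 1) Y ∧ NoFixed G Y) (PowBalanced (j - 1) Z ∧ NoFixed G Z)
    (fun h => ⟨hl _ h.1, hfl h.2⟩) (fun h => ⟨hr _ h.1, hfr h.2⟩)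
    (fun hx hy => ⟨key _ hx.1 hy.1, h.noFixed hx.2 hy.2⟩)
  have e2 := main _ _ _ _ (hl j) (hr j) (key j)
  have e3 := main (PowBalanced (j + 1) I ∧ NoFixed G I) (PowBalanced (j + 1) X ∧ NoFixed G X)
    (PowBalanced (j + 1) Y ∧ NoFixed G Y) (PowBalanced (j + 1) Z ∧ NoFixed G Z)
    (fun h => ⟨hl _ h.1, hfl h.2⟩) (fun h => ⟨hr _ h.1, hfr h.2⟩)
    (fun hx hy => ⟨key _ hx.1 hy.1, h.noFixed hx.2 hy.2⟩)
  unfold alphaSum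
  linarith

/-- Gluing two balanced subgraphs whose intersection becomes connected after deleting a
single vertex. -/
theorem Gluing.redAlpha_le_two_of_balanced (hj : 2 ≤ j) (h : Gluing G₀ I X Y Z)
    (hX : NoFixed G X) (hY : NoFixed G Y) (hXb : PowBalanced 1 X) (hYb : PowBalanced 1 Y)
    {P : Subgraph G} (hP : P ≤ I) {w w' : V} (hw' : w' ∉ P.verts)
    (hconn : ∀ x ∈ P.verts, Reachable G P w x)
    (hcover : ∀ x ∈ I.verts, x ∈ P.verts ∨ x = w') : redAlpha k j Z ≤ 2 := by
  obtain ⟨p, hp⟩ := hX.exists_label_eq_one hXb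
  obtain ⟨q, hq⟩ := hY.exists_label_eq_one hYb
  have hratio : ∀ x ∈ P.verts, ratio p q x = ratio p q w := fun x hx =>
    ratio_eq_of_reachable (F := P) (fun s hs => by
      rw [hp s (h.le_left.2 (hP.2 hs)), hq s (h.le_right.2 (hP.2 hs))]) (hconn x hx)
  refine h.redAlpha_le_two hj hX hY (u := w') (nearPotential_of_label_one hp)
    ((nearPotential_of_shift (δ := (ratio p q w')⁻¹ * ratio p q w) hq
      fun _ _ => rfl).const_mul (ratio p q w)⁻¹) fun x hx => ?_
  rcases hcover x hx with hx | rfl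
  · have hne : x ≠ w' := by rintro rfl; exact hw' hx
    rw [if_neg hne, mul_one, ← hratio x hx, mul_inv_ratio]
  · rw [if_pos rfl, ← mul_assoc, mul_inv_cancel_right, mul_inv_ratio]

/-- The submodular inequality for a gluing. -/
theorem Gluing.count (hj : 2 ≤ j) (hG₀ : CountSparse k j G₀) (h : Gluing G₀ I X Y Z) :
    (I.edges.card : ℤ) + redAlpha k j Z ≤
      redAlpha k j X + redAlpha k j Y - 3 + 2 * (I.freeVerts.card : ℤ) := by
  obtain ⟨w, P, R, hP, hR, hPc, hPE, hw, hwP, hcE, hcV, hE, hdisj, hunion⟩ :=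
    hG₀.exists_piece hj h.le_base h.nonempty
  have le_trans' : ∀ {A B C : Subgraph G}, A ≤ B → B ≤ C → A ≤ C :=
    fun h1 h2 => ⟨h1.1.trans h2.1, h1.2.trans h2.2⟩
  have hPG := le_trans' hP h.le_base
  have hRG := le_trans' hR h.le_base
  have haZ := redAlpha_le_three (k := k) hj h.glued_fixed
  have haX := redAlpha_nonneg (k := k) hj h.left_fixed
  have haY := redAlpha_nonneg (k := k) hj h.right_fixed
  have hPX := hG₀.card_edges_le_of_le hj hPG hPE (le_trans' hP h.le_left) h.left_fixed
    h.left_conn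
  have hPY := hG₀.card_edges_le_of_le hj hPG hPE (le_trans' hP h.le_right) h.right_fixed
    h.right_conn
  by_cases hRE : R.edges.Nonempty
  · have hRY := hG₀.card_edges_le_of_le hj hRG hRE (le_trans' hR h.le_right) h.right_fixed
      h.right_conn
    omega
  rw [Finset.not_nonempty_iff_eq_empty] at hRE
  have hRE' : R.edges.card = 0 := by rw [hRE, Finset.card_empty]
  by_cases hRV : R.freeVerts.Nonempty
  · have hRc := hRV.card_pos
    by_cases hsmall : redAlpha k j X = 0 ∧ redAlpha k j Y = 0 ∧ R.freeVerts.card = 1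
    · obtain ⟨hX0, hY0, hR1⟩ := hsmall
      obtain ⟨hXb, hX⟩ := (redAlpha_eq_zero_iff hj h.left_fixed).1 hX0
      obtain ⟨hYb, hY⟩ := (redAlpha_eq_zero_iff hj h.right_fixed).1 hY0
      obtain ⟨w', hw'⟩ := Finset.card_eq_one.1 hR1
      have hIfix := hX.mono h.le_left
      have hPfix := hIfix.mono hP
      rw [hPfix.freeVerts_eq] at hw hdisj hunion
      rw [hw'] at hdisj hunion
      rw [hIfix.freeVerts_eq] at hunion
      have := h.redAlpha_le_two_of_balanced hj hX hY hXb hYb hP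
        (Finset.disjoint_singleton_right.1 hdisj) (hPc.2 w hw) fun x hx => by
          rw [← hunion] at hx
          simpa [or_comm] using hx
      omega
    · omega
  · rw [Finset.not_nonempty_iff_eq_empty] at hRV
    rw [hRV, Finset.union_empty] at hunion
    have hedges : P.edges = I.edges :=
      hP.2.antisymm fun e he => (hE e he).resolve_right (by simp [hRE])
    have hconn : ∀ x ∈ I.freeVerts, Reachable G (freePart I) w x := fun x hx =>
      (hwP x (hunion.symm ▸ hx)).mono (freePart_mono hP)
    have hIc : NoFixed G I → Connected G I := fun hIfix => by
      rwa [← Subgraph.ext_sets (by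
        rw [← hIfix.freeVerts_eq, ← (hIfix.mono hP).freeVerts_eq, hunion]) hedges]
    by_cases hXnb : FullType j X ∧ NearBalanced G X
    · exact h.count_of_nearBalanced hj hG₀ hXnb.1 hXnb.2 (hIc (hXnb.2.1.mono h.le_left))
    by_cases hYnb : FullType j Y ∧ NearBalanced G Y
    · have := h.symm.count_of_nearBalanced hj hG₀ hYnb.1 hYnb.2
        (hIc (hYnb.2.1.mono h.le_right))
      linarith
    have h1 := hG₀.count P hPG hPE hPc
    have h2 := redAlpha_le_alphaSum (k := k) hj (hG₀.fixed_card_of_le hj hPG)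
    have h3 := alphaSum_mono (j := j) hP
    have h4 := redAlpha_le_alphaSum (k := k) hj h.glued_fixed
    have h5 := alphaSum_add_le (j := j) h hconn
    rw [redAlpha_of_not hj h.left_fixed hXnb, redAlpha_of_not hj h.right_fixed hYnb]
    rw [hunion, hedges] at h1
    linarith

end GluingCount

section Blockers

set_option linter.unusedSectionVars false

variable {V E : Type} [DecidableEq V] [DecidableEq E] {k j : ℕ} [NeZero k]
  {G : GainedGraph V E (Multiplicative (ZMod k))} {G₀ X Y Z H₁ H₂ : Subgraph G} {f₁ f₂ : E}

theorem addEdge_verts {H : Subgraph G} {f : E} (ht : G.tail f ∈ H.verts)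
    (hh : G.head f ∈ H.verts) : (H.addEdge f).verts = H.verts := by
  change insert (G.tail f) (insert (G.head f) H.verts) = H.verts
  rw [Finset.insert_eq_of_mem hh, Finset.insert_eq_of_mem ht]

theorem Connected.of_cover (hX : Connected G X) (hY : Connected G Y) (hXZ : X ≤ Z)
    (hYZ : Y ≤ Z) (hZ : ∀ x ∈ Z.verts, x ∈ X.verts ∨ x ∈ Y.verts) {c : V}
    (hcX : c ∈ X.verts) (hcY : c ∈ Y.verts) : Connected G Z := by
  have key : ∀ x ∈ Z.verts, Reachable G Z c x := fun x hx =>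
    (hZ x hx).elim (fun h => (hX.2 c hcX x h).mono hXZ) fun h => (hY.2 c hcY x h).mono hYZ
  exact ⟨⟨c, hXZ.1 hcX⟩, fun x hx y hy => (key x hx).symm.trans (key y hy)⟩

theorem count_eq_redAlpha {H X : Subgraph G} (h : X.verts = H.verts) :
    2 * (H.verts.card : ℤ) - 3 + alpha G k j X =
      2 * (H.freeVerts.card : ℤ) - 3 + redAlpha k j X := by
  have hf : X.fixedVerts = H.fixedVerts := by rw [Subgraph.fixedVerts, h, Subgraph.fixedVerts]
  rw [card_verts_eq H, redAlpha, hf]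
  ring

theorem card_union_add_inter (H₁ H₂ : Subgraph G) :
    (H₁.union H₂).edges.card + (H₁.inter H₂).edges.card = H₁.edges.card + H₂.edges.card ∧
      (H₁.union H₂).freeVerts.card + (H₁.inter H₂).freeVerts.card =
        H₁.freeVerts.card + H₂.freeVerts.card := by
  refine ⟨Finset.card_union_add_card_inter H₁.edges H₂.edges, ?_⟩
  have h1 : (H₁.union H₂).freeVerts = H₁.freeVerts ∪ H₂.freeVerts :=
    Finset.union_sdiff_distrib _ _ _
  have h2 : (H₁.inter H₂).freeVerts = H₁.freeVerts ∩ H₂.freeVerts := by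
    ext x
    simp only [Subgraph.freeVerts, Subgraph.inter, Finset.mem_sdiff, Finset.mem_inter]
    tauto
  rw [h1, h2, Finset.card_union_add_card_inter]

/-- The count of a union of two subgraphs which are tight after adding one edge each. -/
theorem CountSparse.card_edges_union (hj : 2 ≤ j) (hG₀ : CountSparse k j G₀) (h₁ : H₁ ≤ G₀)
    (h₂ : H₂ ≤ G₀) (ht₁ : G.tail f₁ ∈ H₁.verts) (hh₁ : G.head f₁ ∈ H₁.verts)
    (ht₂ : G.tail f₂ ∈ H₂.verts) (hh₂ : G.head f₂ ∈ H₂.verts)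
    (hc₁ : Connected G (H₁.addEdge f₁)) (hc₂ : Connected G (H₂.addEdge f₂))
    (heq₁ : (H₁.edges.card : ℤ) =
      2 * (H₁.freeVerts.card : ℤ) - 3 + redAlpha k j (H₁.addEdge f₁))
    (heq₂ : (H₂.edges.card : ℤ) =
      2 * (H₂.freeVerts.card : ℤ) - 3 + redAlpha k j (H₂.addEdge f₂))
    (hE : (H₁.inter H₂).edges.Nonempty) :
    ((H₁.union H₂).edges.card : ℤ) = 2 * ((H₁.union H₂).freeVerts.card : ℤ) - 3 +
      redAlpha k j (((H₁.union H₂).addEdge f₁).addEdge f₂) := by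
  set U := H₁.union H₂ with hU
  set Z := (U.addEdge f₁).addEdge f₂ with hZ
  have hXv := addEdge_verts ht₁ hh₁
  have hYv := addEdge_verts ht₂ hh₂
  have hUv₁ : (U.addEdge f₁).verts = U.verts :=
    addEdge_verts (Finset.mem_union_left _ ht₁) (Finset.mem_union_left _ hh₁)
  have hZv : Z.verts = U.verts := by
    rw [hZ, addEdge_verts, hUv₁] <;> rw [hUv₁]
    exacts [Finset.mem_union_right _ ht₂, Finset.mem_union_right _ hh₂]
  have hUG : U ≤ G₀ := ⟨Finset.union_subset h₁.1 h₂.1, by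
    intro e he
    rcases Finset.mem_union.1 he with he | he
    exacts [h₁.2 he, h₂.2 he]⟩
  have hfixed : ∀ K : Subgraph G, K.verts ⊆ G₀.verts → K.fixedVerts.card ≤ 1 := fun K hK =>
    (Finset.card_le_card (Finset.inter_subset_inter_right hK)).trans hG₀.fixed_card
  have hUZ : U ≤ Z := ⟨hZv.symm.subset, fun e he => by simp [hZ, Subgraph.addEdge, he]⟩
  have hXZ : H₁.addEdge f₁ ≤ Z := by
    refine ⟨?_, fun e he => ?_⟩
    · rw [hXv, hZv]
      exact Finset.subset_union_left
    · rcases Finset.mem_insert.1 he with rfl | he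
      · simp [hZ, Subgraph.addEdge]
      · exact hUZ.2 (Finset.mem_union_left _ he)
  have hYZ : H₂.addEdge f₂ ≤ Z := by
    refine ⟨?_, fun e he => ?_⟩
    · rw [hYv, hZv]
      exact Finset.subset_union_right
    · rcases Finset.mem_insert.1 he with rfl | he
      · simp [hZ, Subgraph.addEdge]
      · exact hUZ.2 (Finset.mem_union_right _ he)
  have hglue : Gluing G₀ (H₁.inter H₂) (H₁.addEdge f₁) (H₂.addEdge f₂) Z := by
    refine ⟨⟨Finset.inter_subset_left.trans h₁.1, fun e he => h₁.2 (Finset.mem_inter.1 he).1⟩,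
      ⟨hXv.symm ▸ Finset.inter_subset_left, fun e he =>
        Finset.mem_insert_of_mem (Finset.mem_inter.1 he).1⟩,
      ⟨hYv.symm ▸ Finset.inter_subset_right, fun e he =>
        Finset.mem_insert_of_mem (Finset.mem_inter.1 he).2⟩, ?_, ?_, ?_, hc₁, hc₂,
      hfixed _ (hXv.symm ▸ h₁.1), hfixed _ (hYv.symm ▸ h₂.1), hfixed _ (hZv.symm ▸ hUG.1), hE⟩
    · rw [hXv, hYv]
      exact subset_rfl
    · intro e he
      simp only [hZ, hU, Subgraph.addEdge, Subgraph.union, Finset.mem_insert,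
        Finset.mem_union] at he ⊢
      tauto
    · intro x hx
      rw [hZv] at hx
      rw [hXv, hYv]
      exact Finset.mem_union.1 hx
  obtain ⟨e, he⟩ := hE
  have hZc : Connected G Z := hc₁.of_cover hc₂ hXZ hYZ hglue.verts_mem
    (hglue.le_left.1 ((H₁.inter H₂).tail_mem e he))
    (hglue.le_right.1 ((H₁.inter H₂).tail_mem e he))
  have hupper := hG₀.card_edges_le_of_le hj hUG
    ⟨e, Finset.mem_union_left _ (Finset.mem_inter.1 he).1⟩ hUZ hglue.glued_fixed hZc
  have hlower := hglue.count hj hG₀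
  obtain ⟨hcE, hcV⟩ := card_union_add_inter H₁ H₂
  rw [← hU] at hcE hcV
  omega

end Blockers

/-- If the blockers `H₁, H₂` of two different 1-reductions at `v`
(adding `f₁` and `f₂`) satisfy `E(H₁ ∩ H₂) ≠ ∅`, then with `H = H₁ ∪ H₂` we have
`|E(H)| = 2|V(H)| − 3 + α_k^j(H + f₁ + f₂)`. -/
theorem union_of_blockers_count
    {V E : Type} [DecidableEq V] [DecidableEq E] [Fintype V] [Fintype E]
    (k j : ℕ) (hk : 4 ≤ k) (hj2 : 2 ≤ j) (hjk : j ≤ k - 2)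
    (G : GainedGraph V E (Multiplicative (ZMod k)))
    (G₀ : Subgraph G) (hG₀ : IsGainGraphOn G G₀)
    (htight : GainTightKJ G k j G₀)
    (v : V) (hv : v ∈ G₀.verts) (hvfree : v ∉ G.fixed)
    (hdeg : degree G G₀ v = 3) (hloop : ¬ HasLoopAt G G₀ v)
    (f₁ f₂ : E) (hf₁ : IsOneReduction G G₀ v f₁) (hf₂ : IsOneReduction G G₀ v f₂)
    (hw₁ : IsGainGraphOn G (reduceAt G G₀ v f₁))
    (hw₂ : IsGainGraphOn G (reduceAt G G₀ v f₂))
    (hdiff : ¬ SameEdge G f₁ f₂)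
    (H₁ H₂ : Subgraph G)
    (hb₁ : IsBlocker G k j G₀ v f₁ H₁) (hb₂ : IsBlocker G k j G₀ v f₂ H₂)
    (hE : ((H₁.inter H₂).edges).Nonempty) :
    (((H₁.union H₂).edges.card : ℤ)) =
      2 * (((H₁.union H₂).verts.card : ℤ)) - 3 +
        alpha G k j (((H₁.union H₂).addEdge f₁).addEdge f₂) := by
  have : NeZero k := ⟨by omega⟩
  obtain ⟨h₁, -, ht₁, hh₁, -, hc₁, heq₁⟩ := hb₁
  obtain ⟨h₂, -, ht₂, hh₂, -, hc₂, heq₂⟩ := hb₂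
  have hv₁ := addEdge_verts ht₁ hh₁
  have hv₂ := addEdge_verts ht₂ hh₂
  have hU₁ : ((H₁.union H₂).addEdge f₁).verts = (H₁.union H₂).verts :=
    addEdge_verts (Finset.mem_union_left _ ht₁) (Finset.mem_union_left _ hh₁)
  have hU₂ : (((H₁.union H₂).addEdge f₁).addEdge f₂).verts = (H₁.union H₂).verts := by
    rw [addEdge_verts, hU₁] <;> rw [hU₁]
    exacts [Finset.mem_union_right _ ht₂, Finset.mem_union_right _ hh₂]
  rw [count_eq_redAlpha hv₁] at heq₁
  rw [count_eq_redAlpha hv₂] at heq₂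
  rw [count_eq_redAlpha hU₂]
  exact (htight.1.countSparse hG₀).card_edges_union hj2 h₁ h₂ ht₁ hh₁ ht₂ hh₂ hc₁ hc₂ heq₁ heq₂ hE

end GR
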